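/- arXiv:1207.0390 — 8 statements merged into one kernel-verified Lean document; each statement's English description precedes it below -/
import Mathlib

section
/- Let M be a q-isometry (Mᵀ J M = J) and let λ > 1 be a real root of the characteristic polynomial of M. Then the norms of the powers of M grow exactly like λᵏ: there exist constants c > 0 and C > 0 such that c·λᵏ ≤ ‖Mᵏ‖ ≤ C·λᵏ for every integer k ≥ 1. -/
open Matrix

noncomputable section

/-- The Minkowski form matrix `diag(1, -1, …, -1)` on `ℝ^{n+1}`. -/
def Jmat (n : ℕ) : Matrix (Fin (n + 1)) (Fin (n + 1)) ℝ :=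
  Matrix.diagonal fun i => if i = 0 then (1 : ℝ) else -1

/-- The operator norm of a square real matrix, acting on Euclidean space. -/
def matOpNorm {m : ℕ} (M : Matrix (Fin m) (Fin m) ℝ) : ℝ :=
  ‖Matrix.toEuclideanCLM (𝕜 := ℝ) M‖

lemma aux_form (n : ℕ) (v w : Fin (n+1) → ℝ) :
    v ⬝ᵥ (Jmat n *ᵥ w) = v 0 * w 0 - ∑ i : Fin n, v i.succ * w i.succ := by
  simp [Jmat, dotProduct, Matrix.mulVec_diagonal, Fin.sum_univ_succ, Fin.succ_ne_zero]
  ring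

lemma aux_JJ (n : ℕ) : Jmat n * Jmat n = 1 := by
  rw [Jmat, Matrix.diagonal_mul_diagonal, ← Matrix.diagonal_one]
  congr 1
  ext i
  split_ifs <;> simp

lemma aux_JT (n : ℕ) : (Jmat n)ᵀ = Jmat n := by
  simp [Jmat]

lemma aux_inv {n : ℕ} {M : Matrix (Fin (n + 1)) (Fin (n + 1)) ℝ}
    (hM : Mᵀ * Jmat n * M = Jmat n) : M * Jmat n * Mᵀ = Jmat n := by
  have h1 : (Jmat n * Mᵀ * Jmat n) * M = 1 := by
    rw [← aux_JJ n]; nth_rewrite 4 [← hM]; simp only [Matrix.mul_assoc]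
  have h2 := mul_eq_one_comm.mp h1
  calc M * Jmat n * Mᵀ = (M * (Jmat n * Mᵀ * Jmat n)) * Jmat n := by
        simp only [Matrix.mul_assoc, aux_JJ, Matrix.mul_one]
    _ = Jmat n := by rw [h2, Matrix.one_mul]

lemma aux_pow {n : ℕ} {M : Matrix (Fin (n + 1)) (Fin (n + 1)) ℝ}
    (hM : Mᵀ * Jmat n * M = Jmat n) (k : ℕ) : (M ^ k)ᵀ * Jmat n * M ^ k = Jmat n := by
  induction k with
  | zero => simp
  | succ k ih =>
    calc (M ^ (k+1))ᵀ * Jmat n * M ^ (k+1) = Mᵀ * ((M ^ k)ᵀ * Jmat n * M ^ k) * M := by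
          rw [pow_succ, Matrix.transpose_mul]; simp only [Matrix.mul_assoc]
      _ = _ := by rw [ih, hM]

lemma aux_pres {n : ℕ} {A : Matrix (Fin (n + 1)) (Fin (n + 1)) ℝ}
    (hA : Aᵀ * Jmat n * A = Jmat n) (v w : Fin (n+1) → ℝ) :
    (A *ᵥ v) ⬝ᵥ (Jmat n *ᵥ (A *ᵥ w)) = v ⬝ᵥ (Jmat n *ᵥ w) := by
  conv_rhs => rw [← hA]
  rw [← Matrix.mulVec_mulVec, ← Matrix.mulVec_mulVec, Matrix.dotProduct_mulVec v,
    Matrix.vecMul_transpose]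

/-- operator norm bound by the corner entry -/
lemma aux_norm {n : ℕ} {A : Matrix (Fin (n + 1)) (Fin (n + 1)) ℝ}
    (hA : Aᵀ * Jmat n * A = Jmat n) : matOpNorm A ≤ 2 * |A 0 0| := by
  have hB := aux_inv hA
  have hrow : A 0 0 ^ 2 - ∑ i : Fin n, A 0 i.succ ^ 2 = 1 := by
    have h : (Aᵀ)ᵀ * Jmat n * Aᵀ = Jmat n := by simpa using hB
    have := aux_pres h (Pi.single 0 1) (Pi.single 0 1)
    rw [aux_form, aux_form] at this
    simpa [Fin.succ_ne_zero, ← sq] using this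
  unfold matOpNorm
  refine ContinuousLinearMap.opNorm_le_bound _ (by positivity) fun v => ?_
  have hq := aux_pres hA v.ofLp v.ofLp
  rw [aux_form, aux_form] at hq
  have hcs := Finset.sum_mul_sq_le_sq_mul_sq Finset.univ (fun i => A 0 i) (fun i => v i)
  have h0 : (A *ᵥ v.ofLp) 0 = ∑ i, A 0 i * v i := rfl
  have e1 : ‖Matrix.toEuclideanCLM (𝕜 := ℝ) A v‖ ^ 2 = ∑ i, (A *ᵥ v.ofLp) i ^ 2 := by
    rw [EuclideanSpace.norm_sq_eq]
    simp [Matrix.ofLp_toEuclideanCLM]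
  have e2 : ‖v‖ ^ 2 = ∑ i, v i ^ 2 := by
    rw [EuclideanSpace.norm_sq_eq]
    simp
  refine (sq_le_sq₀ (norm_nonneg _) (by positivity)).mp ?_
  rw [← h0, ← e2] at hcs
  rw [Fin.sum_univ_succ] at e1 e2 hcs
  simp only [← sq] at hq
  rw [mul_pow, mul_pow, sq_abs, e1]
  have e3 : A 0 0 ^ 2 + ∑ i : Fin n, A 0 i.succ ^ 2 = 2 * A 0 0 ^ 2 - 1 := by linarith
  rw [e3] at hcs
  nlinarith [sq_nonneg (v 0)]

lemma aux_null {n : ℕ} {M : Matrix (Fin (n + 1)) (Fin (n + 1)) ℝ}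
    (hM : Mᵀ * Jmat n * M = Jmat n) {m : ℝ} (hm : m ^ 2 ≠ 1) {a : Fin (n+1) → ℝ}
    (ha : M *ᵥ a = m • a) : a 0 * a 0 = ∑ i : Fin n, a i.succ * a i.succ := by
  have h := aux_pres hM a a
  rw [ha, aux_form, aux_form] at h
  simp only [Pi.smul_apply, smul_eq_mul] at h
  have h3 : ∑ i : Fin n, m * a i.succ * (m * a i.succ)
      = m ^ 2 * ∑ i : Fin n, a i.succ * a i.succ := by
    rw [Finset.mul_sum]; exact Finset.sum_congr rfl fun i _ => by ring
  rw [h3] at h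
  have : (m ^ 2 - 1) * (a 0 * a 0 - ∑ i : Fin n, a i.succ * a i.succ) = 0 := by linarith
  rcases mul_eq_zero.mp this with h | h
  · exact absurd (by linarith) hm
  · linarith

lemma aux_zero {n : ℕ} {a : Fin (n+1) → ℝ}
    (h : a 0 * a 0 = ∑ i : Fin n, a i.succ * a i.succ) (h0 : a 0 = 0) : a = 0 := by
  rw [h0, mul_zero, eq_comm, Finset.sum_eq_zero_iff_of_nonneg
    (fun i _ => mul_self_nonneg _)] at h
  ext i
  refine Fin.cases h0 (fun j => ?_) i
  simpa using h j (Finset.mem_univ _)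

lemma aux_orth {n : ℕ} {a y : Fin (n+1) → ℝ}
    (ha : a 0 * a 0 = ∑ i : Fin n, a i.succ * a i.succ)
    (hy : y 0 * y 0 = ∑ i : Fin n, y i.succ * y i.succ)
    (h : a 0 * y 0 = ∑ i : Fin n, a i.succ * y i.succ) (i : Fin (n+1)) :
    y 0 * a i = a 0 * y i := by
  have h1 : ∑ i : Fin n, (y 0 * a i.succ - a 0 * y i.succ) ^ 2 = 0 := by
    have : ∀ i : Fin n, (y 0 * a i.succ - a 0 * y i.succ) ^ 2 =
      y 0 ^ 2 * (a i.succ * a i.succ) + a 0 ^ 2 * (y i.succ * y i.succ)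
        - 2 * a 0 * y 0 * (a i.succ * y i.succ) := fun i => by ring
    simp only [this, Finset.sum_sub_distrib, Finset.sum_add_distrib, ← Finset.mul_sum]
    rw [← ha, ← hy, ← h]; ring
  rw [Finset.sum_eq_zero_iff_of_nonneg (fun i _ => sq_nonneg _)] at h1
  refine Fin.cases (mul_comm _ _) (fun j => ?_) i
  have := pow_eq_zero_iff (two_ne_zero) |>.mp (h1 j (Finset.mem_univ _))
  linarith

lemma aux_time {n : ℕ} {p : Fin (n+1) → ℝ}
    (hp : ∑ i : Fin n, p i.succ * p i.succ < p 0 * p 0) :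
    ∃ D : ℝ, 0 < D ∧ ∀ x : Fin (n+1) → ℝ, ∑ i : Fin n, x i.succ * x i.succ ≤ x 0 * x 0 →
      D * |x 0| ≤ |p ⬝ᵥ x| := by
  refine ⟨|p 0| - √(∑ i : Fin n, p i.succ ^ 2), ?_, fun x hx => ?_⟩
  · rw [sub_pos, ← Real.sqrt_sq_eq_abs]
    apply Real.sqrt_lt_sqrt (Finset.sum_nonneg fun i _ => sq_nonneg _)
    simpa [sq] using hp
  · have h1 : |∑ i : Fin n, p i.succ * x i.succ| ≤
        √(∑ i : Fin n, p i.succ ^ 2) * |x 0| := by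
      have h2 := Finset.sum_mul_sq_le_sq_mul_sq Finset.univ (fun i : Fin n => p i.succ)
        (fun i : Fin n => x i.succ)
      rw [← Real.sqrt_sq_eq_abs, ← Real.sqrt_sq_eq_abs, ← Real.sqrt_mul
        (Finset.sum_nonneg fun i _ => sq_nonneg _)]
      apply Real.sqrt_le_sqrt
      refine h2.trans ?_
      gcongr
      simpa [sq] using hx
    rw [dotProduct, Fin.sum_univ_succ, sub_mul, ← abs_mul]
    have := abs_sub_abs_le_abs_sub (p 0 * x 0) (-∑ i : Fin n, p i.succ * x i.succ)
    rw [abs_neg, sub_neg_eq_add] at this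
    linarith

lemma aux_eig {m : ℕ} {A : Matrix (Fin m) (Fin m) ℝ} {l : ℝ}
    (h : Polynomial.IsRoot A.charpoly l) : ∃ u, u ≠ 0 ∧ A *ᵥ u = l • u := by
  have h1 := Matrix.mem_spectrum_of_isRoot_charpoly h
  rw [← Matrix.spectrum_toLin', ← Module.End.hasEigenvalue_iff_mem_spectrum] at h1
  obtain ⟨u, hu⟩ := h1.exists_hasEigenvector
  exact ⟨u, hu.2, by simpa using hu.apply_eq_smul⟩

lemma aux_eigpow {m : ℕ} {A : Matrix (Fin m) (Fin m) ℝ} {l : ℝ} {u : Fin m → ℝ}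
    (h : A *ᵥ u = l • u) (k : ℕ) : A ^ k *ᵥ u = l ^ k • u := by
  induction k with
  | zero => simp
  | succ k ih =>
    rw [pow_succ, ← Matrix.mulVec_mulVec, h, Matrix.mulVec_smul, ih, smul_smul, pow_succ']

lemma aux_pair {n : ℕ} {M : Matrix (Fin (n + 1)) (Fin (n + 1)) ℝ} {l : ℝ} {a : Fin (n+1) → ℝ}
    (h : Mᵀ *ᵥ a = l • a) (k : ℕ) : a ⬝ᵥ ((M ^ k) *ᵥ Pi.single 0 1) = l ^ k * a 0 := by
  rw [Matrix.dotProduct_mulVec, ← Matrix.mulVec_transpose, Matrix.transpose_pow,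
    aux_eigpow h]
  simp

/-- Remark 2.5(3): if a `q`-isometry `M` has a real eigenvalue `λ > 1`, then
`‖Mᵏ‖` grows exactly like `λᵏ`. -/
theorem stmt_4 (n : ℕ) (hn : 1 ≤ n) (M : Matrix (Fin (n + 1)) (Fin (n + 1)) ℝ)
    (hM : Mᵀ * Jmat n * M = Jmat n) (lam : ℝ) (hlam : 1 < lam)
    (hroot : Polynomial.IsRoot M.charpoly lam) :
    ∃ c C : ℝ, 0 < c ∧ 0 < C ∧ ∀ k : ℕ, 1 ≤ k →
      c * lam ^ k ≤ matOpNorm (M ^ k) ∧ matOpNorm (M ^ k) ≤ C * lam ^ k := by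
  have hl0 : lam ≠ 0 := by positivity
  obtain ⟨u, hu0, hu⟩ := aux_eig hroot
  obtain ⟨y, hy0, hy⟩ := aux_eig (A := Mᵀ) (l := lam) (by rwa [Matrix.charpoly_transpose])
  have hMT : (Mᵀ)ᵀ * Jmat n * Mᵀ = Jmat n := by simpa using aux_inv hM
  obtain ⟨a, ha0, ha⟩ : ∃ a, a ≠ 0 ∧ Mᵀ *ᵥ a = lam⁻¹ • a := by
    refine ⟨Jmat n *ᵥ u, fun h => hu0 ?_, ?_⟩
    · have := congrArg (Jmat n *ᵥ ·) h
      simpa [Matrix.mulVec_mulVec, aux_JJ] using this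
    · have h1 : u = lam⁻¹ • (M *ᵥ u) := by rw [hu, smul_smul, inv_mul_cancel₀ hl0, one_smul]
      nth_rewrite 1 [h1]
      rw [Matrix.mulVec_smul, Matrix.mulVec_smul, Matrix.mulVec_mulVec, Matrix.mulVec_mulVec,
        hM]
  have hl2 : 1 < lam ^ 2 := one_lt_pow₀ hlam two_ne_zero
  have hny := aux_null hMT hl2.ne' hy
  have hna := aux_null hMT (by rw [inv_pow]; exact (inv_lt_one_of_one_lt₀ hl2).ne) ha
  have hne : a 0 * y 0 - ∑ i : Fin n, a i.succ * y i.succ ≠ 0 := by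
    intro h
    have h1 := aux_orth hna hny (sub_eq_zero.mp h)
    have h2 : y 0 • a = a 0 • y := by ext i; simpa using h1 i
    have h3 := congrFun (congrArg (Mᵀ *ᵥ ·) h2) 0
    simp only [Matrix.mulVec_smul, ha, hy, Pi.smul_apply, smul_eq_mul] at h3
    have h4 : (lam ^ 2 - 1) * (a 0 * y 0) = 0 := by
      field_simp at h3
      linarith
    rcases mul_eq_zero.mp h4 with h | h
    · linarith
    rcases mul_eq_zero.mp h with h | h
    · exact ha0 (aux_zero hna h)
    · exact hy0 (aux_zero hny h)
  obtain ⟨s, hs⟩ : ∃ s : ℝ, 0 < s * (a 0 * y 0 - ∑ i : Fin n, a i.succ * y i.succ) :=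
    ⟨_, mul_self_pos.mpr hne⟩
  have hp : ∑ i : Fin n, (a + s • y) i.succ * (a + s • y) i.succ
      < (a + s • y) 0 * (a + s • y) 0 := by
    have : ∀ i, (a + s • y) i * (a + s • y) i =
      a i * a i + s ^ 2 * (y i * y i) + 2 * s * (a i * y i) := fun i => by
        simp only [Pi.add_apply, Pi.smul_apply, smul_eq_mul]; ring
    simp only [this, Finset.sum_add_distrib, ← Finset.mul_sum]
    rw [← hna, ← hny]
    linarith
  obtain ⟨D, hD, hDx⟩ := aux_time hp
  refine ⟨1, 2 * ((|a 0| + |s| * |y 0| + 1) / D), one_pos, by positivity, fun k _ => ⟨?_, ?_⟩⟩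
  · have h1 := (Matrix.toEuclideanCLM (𝕜 := ℝ) (M ^ k)).le_opNorm (WithLp.toLp 2 u)
    have h2 : Matrix.toEuclideanCLM (𝕜 := ℝ) (M ^ k) (WithLp.toLp 2 u)
        = lam ^ k • WithLp.toLp 2 u := by
      rw [Matrix.toEuclideanCLM_toLp, aux_eigpow hu]; rfl
    rw [h2, norm_smul, Real.norm_of_nonneg (by positivity)] at h1
    have h3 : 0 < ‖WithLp.toLp 2 u‖ := by
      rw [norm_pos_iff]; intro h; exact hu0 (by simpa using h)
    rw [one_mul]
    exact le_of_mul_le_mul_right h1 h3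
  · refine (aux_norm (aux_pow hM k)).trans ?_
    rw [mul_assoc]
    gcongr
    rw [div_mul_eq_mul_div, le_div_iff₀ hD, mul_comm]
    have hx := aux_pres (aux_pow hM k) (Pi.single 0 1) (Pi.single 0 1)
    rw [aux_form, aux_form] at hx
    have hx2 := hDx (M ^ k *ᵥ Pi.single 0 1) (by
      simp [Fin.succ_ne_zero] at hx ⊢
      linarith)
    rw [add_dotProduct, smul_dotProduct, aux_pair ha, aux_pair hy] at hx2
    have hx3 : (M ^ k *ᵥ Pi.single 0 1) 0 = (M ^ k) 0 0 := by simp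
    rw [hx3] at hx2
    refine hx2.trans ((abs_add_le _ _).trans ?_)
    have e1 : 1 ≤ lam ^ k := one_le_pow₀ hlam.le
    have e2 : lam⁻¹ ^ k ≤ lam ^ k := by
      rw [inv_pow]; exact (inv_le_one_of_one_le₀ e1).trans e1
    rw [smul_eq_mul, abs_mul, abs_mul, abs_mul, abs_of_nonneg (by positivity : 0 ≤ lam⁻¹ ^ k),
      abs_of_nonneg (by positivity : 0 ≤ lam ^ k)]
    have := mul_le_mul_of_nonneg_right e2 (abs_nonneg (a 0))
    nlinarith
end
end

section
/- Let M be a q-isometry (Mᵀ J M = J) and let F ⊆ ℝ^{n+1} be an M-invariant linear subspace containing some vector w with q(w) > 0. Then the J-orthogonal complement F^⊥ = {v ∈ ℝ^{n+1} : ⟨v, w⟩ = 0 for all w ∈ F} is M-invariant, and the powers of M are uniformly bounded on F^⊥: there exists C > 0 such that ‖Mᵏ v‖ ≤ C·‖v‖ for every k ∈ ℕ and every v ∈ F^⊥. (Consequently the growth type of ‖Mᵏ‖ is determined by the restriction of M to F.) -/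
open Matrix

noncomputable section

/-- The Minkowski quadratic form `q(v) = vᵀ J v` of signature `(1, n)`. -/
def qform (n : ℕ) (v : Fin (n + 1) → ℝ) : ℝ := v ⬝ᵥ (Jmat n).mulVec v

/-- The polar bilinear form `⟨v, w⟩ = vᵀ J w`. -/
def bform (n : ℕ) (v w : Fin (n + 1) → ℝ) : ℝ := v ⬝ᵥ (Jmat n).mulVec w

/-- The `J`-orthogonal complement of a subspace `F` of `ℝ^{n+1}`. -/
def perpOf (n : ℕ) (F : Submodule ℝ (Fin (n + 1) → ℝ)) : Submodule ℝ (Fin (n + 1) → ℝ) where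
  carrier := {v | ∀ w ∈ F, bform n v w = 0}
  zero_mem' := fun w _ => by simp [bform]
  add_mem' := by
    intro a b ha hb w hw
    have h1 := ha w hw
    have h2 := hb w hw
    simp only [bform] at h1 h2 ⊢
    rw [add_dotProduct, h1, h2, add_zero]
  smul_mem' := by
    intro c a ha w hw
    have h1 := ha w hw
    simp only [bform] at h1 ⊢
    rw [smul_dotProduct, h1, smul_zero]

/-- The Euclidean norm on `ℝ^{n+1}`. -/
def enorm (n : ℕ) (v : Fin (n + 1) → ℝ) : ℝ := Real.sqrt (∑ i, v i ^ 2)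

theorem bform_eq (n : ℕ) (v w : Fin (n + 1) → ℝ) :
    bform n v w = v 0 * w 0 - ∑ i : Fin n, v i.succ * w i.succ := by
  simp [bform, Jmat, dotProduct, Matrix.mulVec_diagonal, Fin.sum_univ_succ, Fin.succ_ne_zero,
    Finset.sum_neg_distrib, sub_eq_add_neg]

theorem bform_isom (n : ℕ) (M : Matrix (Fin (n + 1)) (Fin (n + 1)) ℝ)
    (hM : Mᵀ * Jmat n * M = Jmat n) (v w : Fin (n + 1) → ℝ) :
    bform n (M.mulVec v) (M.mulVec w) = bform n v w := by
  unfold bform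
  conv_rhs => rw [← hM]
  rw [← Matrix.mulVec_mulVec, ← Matrix.mulVec_mulVec, Matrix.dotProduct_mulVec v,
    Matrix.vecMul_transpose]

theorem M_inj (n : ℕ) (M : Matrix (Fin (n + 1)) (Fin (n + 1)) ℝ)
    (hM : Mᵀ * Jmat n * M = Jmat n) : Function.Injective M.mulVec := by
  have hJ : Jmat n * Jmat n = 1 := by
    unfold Jmat
    rw [Matrix.diagonal_mul_diagonal, ← Matrix.diagonal_one]
    congr 1
    funext i
    split_ifs <;> norm_num
  have h : (Jmat n * Mᵀ * Jmat n) * M = 1 := by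
    rw [Matrix.mul_assoc (Jmat n), Matrix.mul_assoc (Jmat n), hM, hJ]
  intro a b hab
  have := congrArg (Jmat n * Mᵀ * Jmat n).mulVec hab
  simpa [Matrix.mulVec_mulVec, h] using this

theorem perp_inv (n : ℕ) (M : Matrix (Fin (n + 1)) (Fin (n + 1)) ℝ)
    (hM : Mᵀ * Jmat n * M = Jmat n) (F : Submodule ℝ (Fin (n + 1) → ℝ))
    (hinv : ∀ v ∈ F, M.mulVec v ∈ F) (v : Fin (n + 1) → ℝ) (hv : v ∈ perpOf n F) :
    M.mulVec v ∈ perpOf n F := by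
  intro u hu
  let T : F →ₗ[ℝ] F := (Matrix.mulVecLin M).restrict hinv
  have hT : Function.Injective T := by
    intro a b hab
    apply Subtype.ext
    apply M_inj n M hM
    exact congrArg Subtype.val hab
  obtain ⟨x, hx⟩ := (LinearMap.injective_iff_surjective.mp hT) ⟨u, hu⟩
  have hx' : M.mulVec x.1 = u := congrArg Subtype.val hx
  rw [← hx', bform_isom n M hM]
  exact hv x.1 x.2

theorem stmt_8 (n : ℕ) (hn : 1 ≤ n) (M : Matrix (Fin (n + 1)) (Fin (n + 1)) ℝ)
    (hM : Mᵀ * Jmat n * M = Jmat n) (F : Submodule ℝ (Fin (n + 1) → ℝ))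
    (hinv : ∀ v ∈ F, M.mulVec v ∈ F)
    (w : Fin (n + 1) → ℝ) (hwF : w ∈ F) (hqw : 0 < qform n w) :
    (∀ v ∈ perpOf n F, M.mulVec v ∈ perpOf n F) ∧
    ∃ C : ℝ, 0 < C ∧ ∀ (k : ℕ), ∀ v ∈ perpOf n F,
      enorm n ((M ^ k).mulVec v) ≤ C * enorm n v := by
  have hP := perp_inv n M hM F hinv
  refine ⟨hP, ?_⟩
  have hw : 0 < w 0 ^ 2 - ∑ i : Fin n, w i.succ ^ 2 := by
    have h : qform n w = bform n w w := rfl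
    rw [h, bform_eq] at hqw
    simpa [sq] using hqw
  set a := ∑ i : Fin n, w i.succ ^ 2 with ha
  have ha0 : 0 ≤ a := Finset.sum_nonneg fun i _ => sq_nonneg _
  have hK : 0 < (w 0 ^ 2 + a) / (w 0 ^ 2 - a) := div_pos (by linarith) hw
  have key : ∀ v ∈ perpOf n F,
      ∑ i, v i ^ 2 ≤ (w 0 ^ 2 + a) / (w 0 ^ 2 - a) * (- bform n v v) := by
    intro v hv
    have h1 := hv w hwF
    rw [bform_eq] at h1
    have hcs := Finset.sum_mul_sq_le_sq_mul_sq Finset.univ (fun i : Fin n => v i.succ)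
      (fun i : Fin n => w i.succ)
    rw [← ha, ← sub_eq_zero.mp h1] at hcs
    rw [bform_eq, Fin.sum_univ_succ, div_mul_eq_mul_div, le_div_iff₀ hw]
    simp only [← sq]
    set S := ∑ i : Fin n, v i.succ ^ 2
    nlinarith
  refine ⟨Real.sqrt ((w 0 ^ 2 + a) / (w 0 ^ 2 - a)), Real.sqrt_pos.mpr hK, ?_⟩
  intro k v hv
  have hk : (M ^ k).mulVec v ∈ perpOf n F ∧
      bform n ((M ^ k).mulVec v) ((M ^ k).mulVec v) = bform n v v := by
    induction k with
    | zero => simpa using hv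
    | succ k ih =>
      rw [pow_succ', ← Matrix.mulVec_mulVec, bform_isom n M hM]
      exact ⟨hP _ ih.1, ih.2⟩
  unfold _root_.enorm
  rw [← Real.sqrt_mul hK.le]
  apply Real.sqrt_le_sqrt
  refine (key _ hk.1).trans ?_
  rw [hk.2]
  apply mul_le_mul_of_nonneg_left _ hK.le
  rw [bform_eq, Fin.sum_univ_succ]
  simp only [← sq]
  nlinarith [sq_nonneg (v 0)]
end
end

section
/- Let B ∈ M₂(ℤ) be a symmetric matrix with det B < 0 such that the discriminant δ = −det B is not a perfect square. Then the lattice (ℤ², B) admits a hyperbolic isometry: there exists a matrix M ∈ M₂(ℤ) with Mᵀ B M = B, det M = 1, and a real eigenvalue λ > 1 (so the spectral radius of M is greater than 1). -/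
open Matrix

/-- Section 8.2.1: a rank-2 hyperbolic lattice whose discriminant `δ = -det B` is
not a perfect square admits a hyperbolic direct isometry: a matrix `M ∈ M₂(ℤ)` with
`Mᵀ B M = B`, `det M = 1`, and a real eigenvalue `λ > 1`. -/
theorem stmt_12 (B : Matrix (Fin 2) (Fin 2) ℤ) (hsym : Bᵀ = B) (hdet : B.det < 0)
    (hns : ¬ IsSquare (-B.det)) :
    ∃ M : Matrix (Fin 2) (Fin 2) ℤ, Mᵀ * B * M = B ∧ M.det = 1 ∧
      ∃ lam : ℝ, 1 < lam ∧ Polynomial.aeval lam M.charpoly = 0 := by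
  obtain ⟨s, hx, -⟩ := Pell.Solution₁.exists_pos_of_not_isSquare (by linarith) hns
  have hp := s.prop
  generalize s.x = x at hx hp
  generalize s.y = y at hp
  have h10 : B 1 0 = B 0 1 := congrFun (congrFun hsym 0) 1
  obtain ⟨a, ha⟩ : ∃ a, a = B 0 0 := ⟨_, rfl⟩
  obtain ⟨b, hb⟩ : ∃ b, b = B 0 1 := ⟨_, rfl⟩
  obtain ⟨c, hc⟩ : ∃ c, c = B 1 1 := ⟨_, rfl⟩
  have hB : B = !![a, b; b, c] := by
    ext i j
    fin_cases i <;> fin_cases j <;> simp [ha, hb, hc, h10]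
  clear ha hb hc h10
  subst hB
  rw [Matrix.det_fin_two_of] at hp
  have hM : (!![x - y * b, -(y * c); y * a, x + y * b] : Matrix (Fin 2) (Fin 2) ℤ).det = 1 := by
    rw [Matrix.det_fin_two_of]; linear_combination hp
  refine ⟨!![x - y * b, -(y * c); y * a, x + y * b], ?_, hM, ?_⟩
  · ext i j
    fin_cases i <;> fin_cases j <;> simp [Matrix.mul_apply, Fin.sum_univ_two]
    · linear_combination a * hp
    · linear_combination b * hp
    · linear_combination b * hp
    · linear_combination c * hp
  · have hx' : (1 : ℝ) < x := by exact_mod_cast hx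
    refine ⟨x + √((x : ℝ) ^ 2 - 1), ?_, ?_⟩
    · have := Real.sqrt_nonneg ((x : ℝ) ^ 2 - 1)
      linarith
    · have h := Real.sq_sqrt (show (0 : ℝ) ≤ (x : ℝ) ^ 2 - 1 by nlinarith)
      rw [Matrix.charpoly_fin_two, hM, Matrix.trace_fin_two_of]
      simp
      linear_combination h
end

section
/- Let B ∈ M₂(ℤ) be a symmetric matrix with det B < 0 such that the discriminant δ = −det B is not a perfect square. Then the group Isom⁺(ℤ², B) = {M ∈ M₂(ℤ) : det M = 1 and Mᵀ B M = B} of direct isometries of the lattice, under matrix multiplication, is an abelian group isomorphic to ℤ × ℤ/2ℤ. -/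
open Matrix

/-- The direct isometries of the lattice `(ℤ², B)`: matrices `M ∈ M₂(ℤ)` with
`det M = 1` and `Mᵀ B M = B`. They form a submonoid of the matrix ring (which is
in fact a group, as asserted by the theorem below). -/
def isomPlus (B : Matrix (Fin 2) (Fin 2) ℤ) : Submonoid (Matrix (Fin 2) (Fin 2) ℤ) where
  carrier := {M | M.det = 1 ∧ Mᵀ * B * M = B}
  one_mem' := ⟨by simp, by simp⟩
  mul_mem' := by
    rintro a b ⟨ha1, ha2⟩ ⟨hb1, hb2⟩
    refine ⟨by rw [Matrix.det_mul, ha1, hb1, one_mul], ?_⟩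
    rw [Matrix.transpose_mul]
    calc bᵀ * aᵀ * B * (a * b) = bᵀ * (aᵀ * B * a) * b := by
          simp only [mul_assoc]
      _ = bᵀ * B * b := by rw [ha2]
      _ = B := hb2

lemma abstract_iso {G : Type*} [Monoid G] (φ : G →* ℝ) (hinj : Function.Injective φ)
    (hinv : ∀ g : G, ∃ h : G, g * h = 1) (e : G) (he : φ e = -1)
    (hex : ∃ g, 1 < φ g) (hgap : ∀ g, 1 < φ g → 2 ≤ φ g) :
    Nonempty (G ≃* Multiplicative (ℤ × ZMod 2)) := by
  let H : AddSubgroup ℝ :=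
    { carrier := {x | ∃ g, φ g = Real.exp x}
      zero_mem' := ⟨1, by simp⟩
      add_mem' := by
        rintro x y ⟨g, hg⟩ ⟨h, hh⟩
        exact ⟨g * h, by rw [map_mul, hg, hh, Real.exp_add]⟩
      neg_mem' := by
        rintro x ⟨g, hg⟩
        obtain ⟨h, hh⟩ := hinv g
        refine ⟨h, ?_⟩
        have h1 : φ g * φ h = 1 := by rw [← map_mul, hh, map_one]
        rw [Real.exp_neg, ← hg]
        exact eq_inv_of_mul_eq_one_right h1 }
  have hH : ∀ x, x ∈ H ↔ ∃ g, φ g = Real.exp x := fun x => Iff.rfl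
  obtain ⟨a, ha⟩ : ∃ a, H = AddSubgroup.closure {a} := by
    apply AddSubgroup.cyclic_of_isolated_zero (a := Real.log 2) (Real.log_pos (by norm_num))
    rw [Set.disjoint_left]
    rintro x hx ⟨h0, h1⟩
    obtain ⟨g, hg⟩ := (hH x).1 hx
    have h2 := hgap g (by rw [hg]; exact Real.one_lt_exp_iff.2 h0)
    rw [hg] at h2
    have := (Real.lt_log_iff_exp_lt (by norm_num)).1 h1
    linarith
  have hmem : ∀ x, (∃ g, φ g = Real.exp x) ↔ ∃ n : ℤ, x = n * a := by
    intro x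
    rw [← hH, ha, AddSubgroup.mem_closure_singleton]
    simp [eq_comm]
  have ha0 : a ≠ 0 := by
    rintro rfl
    obtain ⟨g, hg⟩ := hex
    obtain ⟨n, hn⟩ := (hmem (Real.log (φ g))).1 ⟨g, (Real.exp_log (by linarith)).symm⟩
    have := Real.log_pos hg
    simp at hn
    rcases hn with h | h | h <;> linarith
  let σ : ZMod 2 → ℝ := fun i => if i = 0 then 1 else -1
  have hσ : ∀ i j, σ (i + j) = σ i * σ j := by
    intro i j
    have hd : ∀ i : ZMod 2, i = 0 ∨ i = 1 := by decide
    have h11 : (1 + 1 : ZMod 2) = 0 := rfl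
    rcases hd i with rfl | rfl <;> rcases hd j with rfl | rfl <;> simp [σ, h11]
  have hF : ∀ z : Multiplicative (ℤ × ZMod 2), ∃ g : G,
      φ g = Real.exp (z.toAdd.1 * a) * σ z.toAdd.2 := by
    intro z
    obtain ⟨g, hg⟩ := (hmem (z.toAdd.1 * a)).2 ⟨_, rfl⟩
    by_cases h : z.toAdd.2 = 0
    · exact ⟨g, by simp [σ, h, hg]⟩
    · exact ⟨g * e, by simp [σ, h, hg, he]⟩
  choose F hF using hF
  have hmul : ∀ x y, F (x * y) = F x * F y := by
    intro x y
    apply hinj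
    rw [map_mul, hF, hF, hF, toAdd_mul, Prod.fst_add, Prod.snd_add, hσ]
    push_cast
    rw [add_mul, Real.exp_add]
    ring
  have hbij : Function.Bijective F := by
    constructor
    · intro x y hxy
      have h := hF x
      rw [hxy, hF y] at h
      have e1 := Real.exp_pos (x.toAdd.1 * a)
      have e2 := Real.exp_pos (y.toAdd.1 * a)
      have key : Real.exp (y.toAdd.1 * a) = Real.exp (x.toAdd.1 * a) → x.toAdd.1 = y.toAdd.1 := by
        intro h
        have := mul_right_cancel₀ ha0 (Real.exp_injective h)
        exact_mod_cast this.symm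
      have h2 : ∀ i j : ZMod 2, i ≠ 0 → j ≠ 0 → i = j := by decide
      by_cases hx : x.toAdd.2 = 0 <;> by_cases hy : y.toAdd.2 = 0 <;> simp only [σ, hx, hy, if_true, if_false] at h
      · exact Multiplicative.toAdd.injective (Prod.ext (key (by linarith)) (hx.trans hy.symm))
      · linarith
      · linarith
      · exact Multiplicative.toAdd.injective (Prod.ext (key (by linarith)) (h2 _ _ hx hy))
    · intro g
      have hne : φ g ≠ 0 := by
        obtain ⟨h, hh⟩ := hinv g
        intro h0
        have h1 : φ g * φ h = 1 := by rw [← map_mul, hh, map_one]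
        simp [h0] at h1
      rcases lt_or_gt_of_ne hne with h | h
      · obtain ⟨n, hn⟩ := (hmem (Real.log (-φ g))).1 ⟨g * e, by
          rw [Real.exp_log (by linarith), map_mul, he]; ring⟩
        refine ⟨Multiplicative.ofAdd (n, 1), hinj ?_⟩
        rw [hF]
        simp only [toAdd_ofAdd]
        rw [← hn, Real.exp_log (by linarith)]
        simp [σ]
      · obtain ⟨n, hn⟩ := (hmem (Real.log (φ g))).1 ⟨g, by
          rw [Real.exp_log (by linarith)]⟩
        refine ⟨Multiplicative.ofAdd (n, 0), hinj ?_⟩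
        rw [hF]
        simp only [toAdd_ofAdd]
        rw [← hn, Real.exp_log (by linarith)]
        simp [σ]
  exact ⟨(MulEquiv.ofBijective (⟨F, hmul⟩ : MulHom _ _) hbij).symm⟩

lemma mem_isomPlus_iff (a b c p q r s : ℤ) :
    !![p, q; r, s] ∈ isomPlus !![a, b; b, c] ↔
      p * s - q * r = 1 ∧ a * (s - p) = 2 * b * r ∧ a * q = - (c * r) ∧
        c * (p - s) = 2 * b * q := by
  change (_ ∧ _) ↔ _
  rw [Matrix.det_fin_two_of]
  apply and_congr_right
  intro hd
  have e1 : !![p, q; r, s]ᵀ * !![a, b; b, c] * !![p, q; r, s] = !![a, b; b, c] ↔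
     ((p * a + r * b) * p + (p * b + r * c) * r = a ∧ (p * a + r * b) * q + (p * b + r * c) * s = b)
     ∧ ((q * a + s * b) * p + (q * b + s * c) * r = b ∧
      (q * a + s * b) * q + (q * b + s * c) * s = c) := by
    rw [← Matrix.ext_iff]
    simp [Fin.forall_fin_two, Matrix.mul_apply, Fin.sum_univ_two]
  rw [e1]
  constructor
  · rintro ⟨⟨h1, h2⟩, h3, h4⟩
    refine ⟨?_, ?_, ?_⟩
    · linear_combination (-s) * h1 + r * h2 + (p * a + r * b) * hd
    · linear_combination (-q) * h1 + p * h2 + (-p * b - r * c) * hd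
    · linear_combination q * h3 - p * h4 + (q * b + s * c) * hd
  · rintro ⟨h1, h2, h3⟩
    refine ⟨⟨?_, ?_⟩, ?_, ?_⟩
    · linear_combination (-p) * h1 + r * h2 + a * hd
    · linear_combination (-q) * h1 + s * h2 + b * hd
    · linear_combination p * h2 - r * h3 + b * hd
    · linear_combination q * h2 - s * h3 + c * hd

/-- Section 8.2.1: if the discriminant `δ = -det B` is not a perfect square, the
group of direct isometries of the lattice `(ℤ², B)` is abelian and isomorphic to
`ℤ × ℤ/2ℤ`. -/
theorem stmt_13 (B : Matrix (Fin 2) (Fin 2) ℤ) (hsym : Bᵀ = B) (hdet : B.det < 0)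
    (hns : ¬ IsSquare (-B.det)) :
    (∀ x y : isomPlus B, x * y = y * x) ∧
    Nonempty (isomPlus B ≃* Multiplicative (ℤ × ZMod 2)) := by
  obtain ⟨a, b, c, rfl⟩ : ∃ a b c, B = !![a, b; b, c] := by
    refine ⟨B 0 0, B 0 1, B 1 1, ?_⟩
    have h : B 1 0 = B 0 1 := congrFun (congrFun hsym 0) 1
    rw [Matrix.eta_fin_two B]
    simp [h]
  rw [Matrix.det_fin_two_of] at hdet hns
  obtain ⟨d, hd⟩ : ∃ d, d = -(a * c - b * b) := ⟨_, rfl⟩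
  rw [← hd] at hns
  have hd0 : 0 < d := by linarith
  have ha : a ≠ 0 := by
    rintro rfl
    exact hns ⟨b, by linarith⟩
  have haR : (a : ℝ) ≠ 0 := by exact_mod_cast ha
  have hmat : ∀ M : Matrix (Fin 2) (Fin 2) ℤ, M = !![M 0 0, M 0 1; M 1 0, M 1 1] :=
    fun M => Matrix.eta_fin_two M
  have hG : ∀ M : isomPlus !![a, b; b, c], M.1 0 0 * M.1 1 1 - M.1 0 1 * M.1 1 0 = 1 ∧
      a * (M.1 1 1 - M.1 0 0) = 2 * b * M.1 1 0 ∧ a * M.1 0 1 = - (c * M.1 1 0) ∧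
        c * (M.1 0 0 - M.1 1 1) = 2 * b * M.1 0 1 := by
    intro M
    have := M.2
    rw [hmat M.1] at this
    exact (mem_isomPlus_iff ..).1 this
  obtain ⟨w, hw⟩ : ∃ w, w = √(d : ℝ) := ⟨_, rfl⟩
  have hw2 : w * w = b * b - a * c := by
    rw [hw, Real.mul_self_sqrt (by exact_mod_cast hd0.le), hd]
    push_cast; ring
  have hirr : Irrational w := by
    rw [hw]
    exact (irrational_sqrt_intCast_iff_of_nonneg hd0.le).2 hns
  obtain ⟨κ, hκ⟩ : ∃ κ, κ = (b + w) / a := ⟨_, rfl⟩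
  have hκa : a * κ = b + w := by rw [hκ]; field_simp
  have hκ2 : a * κ ^ 2 = 2 * b * κ - c := by
    apply mul_left_cancel₀ haR
    linear_combination (a * κ + b + w) * hκa - 2 * b * hκa + hw2
  have hkey : ∀ M : isomPlus !![a, b; b, c],
      (M.1 1 0 : ℝ) * κ ^ 2 = M.1 0 1 + (M.1 1 1 - M.1 0 0) * κ := by
    intro M
    obtain ⟨h1, h2, h3, h4⟩ := hG M
    have h2' : (a : ℝ) * (M.1 1 1 - M.1 0 0) = 2 * b * M.1 1 0 := by exact_mod_cast h2
    have h3' : (a : ℝ) * M.1 0 1 = - (c * M.1 1 0) := by exact_mod_cast h3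
    apply mul_left_cancel₀ haR
    linear_combination (M.1 1 0 : ℝ) * hκ2 - h3' - κ * h2'
  let φ : isomPlus !![a, b; b, c] →* ℝ :=
    { toFun := fun M => M.1 0 0 + M.1 1 0 * κ
      map_one' := by simp
      map_mul' := by
        intro M N
        simp only [Submonoid.coe_mul, Matrix.mul_apply, Fin.sum_univ_two]
        push_cast
        linear_combination (-(N.1 1 0 : ℝ)) * hkey M }
  have hφ : ∀ M, φ M = M.1 0 0 + M.1 1 0 * κ := fun M => rfl
  have hinj : Function.Injective φ := by
    intro M N h
    rw [hφ, hφ] at h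
    obtain ⟨m1, m2, m3, m4⟩ := hG M
    obtain ⟨n1, n2, n3, n4⟩ := hG N
    have hr : M.1 1 0 = N.1 1 0 := by
      by_contra hne
      have hne' : ((M.1 1 0 - N.1 1 0 : ℤ) : ℝ) ≠ 0 := by exact_mod_cast sub_ne_zero.2 hne
      apply hirr
      refine ⟨((a * (N.1 0 0 - M.1 0 0) : ℤ) : ℚ) / ((M.1 1 0 - N.1 1 0 : ℤ) : ℚ) - (b : ℚ), ?_⟩
      rw [Rat.cast_sub, Rat.cast_div, Rat.cast_intCast, Rat.cast_intCast, Rat.cast_intCast,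
        sub_eq_iff_eq_add, div_eq_iff hne']
      push_cast
      linear_combination (-(a : ℝ)) * h + (M.1 1 0 - N.1 1 0 : ℝ) * hκa
    have hp : M.1 0 0 = N.1 0 0 := by
      rw [hr] at h
      exact_mod_cast add_right_cancel h
    have hq : M.1 0 1 = N.1 0 1 := by
      apply mul_left_cancel₀ ha
      rw [m3, n3, hr]
    have hs : M.1 1 1 = N.1 1 1 := by
      apply mul_left_cancel₀ ha
      linear_combination m2 - n2 + 2 * b * hr + a * hp
    apply Subtype.ext
    rw [hmat M.1, hmat N.1, hr, hp, hq, hs]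
  refine ⟨fun x y => hinj (by rw [map_mul, map_mul, mul_comm]), ?_⟩
  refine abstract_iso φ hinj ?_ ⟨!![-1, 0; 0, -1], ?_⟩ ?_ ?_ ?_
  · intro M
    obtain ⟨h1, h2, h3, h4⟩ := hG M
    refine ⟨⟨!![M.1 1 1, -M.1 0 1; -M.1 1 0, M.1 0 0], ?_⟩, ?_⟩
    · rw [mem_isomPlus_iff]
      refine ⟨?_, ?_, ?_, ?_⟩ <;> linarith
    · apply Subtype.ext
      change M.1 * _ = 1
      rw [Matrix.one_fin_two]
      nth_rewrite 1 [hmat M.1]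
      rw [Matrix.mul_fin_two]
      have e1 : M.1 0 0 * M.1 1 1 + M.1 0 1 * -M.1 1 0 = 1 := by linarith
      have e2 : M.1 0 0 * -M.1 0 1 + M.1 0 1 * M.1 0 0 = 0 := by ring
      have e3 : M.1 1 0 * M.1 1 1 + M.1 1 1 * -M.1 1 0 = 0 := by ring
      have e4 : M.1 1 0 * -M.1 0 1 + M.1 1 1 * M.1 0 0 = 1 := by linarith
      rw [e1, e2, e3, e4]
  · rw [mem_isomPlus_iff]; simp
  · rw [hφ]; simp
  · obtain ⟨S, hx, hy⟩ := Pell.Solution₁.exists_pos_of_not_isSquare hd0 hns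
    have hp := S.prop
    refine ⟨⟨!![S.x - b * S.y, -c * S.y; a * S.y, S.x + b * S.y], ?_⟩, ?_⟩
    · rw [mem_isomPlus_iff]
      refine ⟨?_, by ring, by ring, by ring⟩
      linear_combination hp + S.y ^ 2 * hd
    · rw [hφ]
      simp only [Matrix.of_apply, Matrix.cons_val', Matrix.cons_val_zero, Matrix.cons_val_one,
        Matrix.cons_val_fin_one]
      push_cast
      have h1 : (1 : ℝ) < S.x := by exact_mod_cast hx
      have h2 : (0 : ℝ) < S.y := by exact_mod_cast hy
      have h3 : 0 ≤ w := hw ▸ Real.sqrt_nonneg _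
      have h4 : (S.x - b * S.y + a * S.y * κ : ℝ) = S.x + S.y * w := by
        linear_combination (S.y : ℝ) * hκa
      rw [h4]
      have := mul_nonneg h2.le h3
      linarith
  · intro M hM
    rw [hφ] at hM ⊢
    obtain ⟨h1, h2, h3, h4⟩ := hG M
    have h1' : (M.1 0 0 : ℝ) * M.1 1 1 - M.1 0 1 * M.1 1 0 = 1 := by exact_mod_cast h1
    have hk := hkey M
    obtain ⟨t, ht⟩ : ∃ t : ℝ, t = M.1 0 0 + M.1 1 0 * κ := ⟨_, rfl⟩
    rw [← ht] at hM ⊢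
    have hchar : t * ((M.1 0 0 + M.1 1 1 : ℤ) - t) = 1 := by
      rw [ht]; push_cast
      linear_combination h1' - (M.1 1 0 : ℝ) * hk
    have hpos : 0 < ((M.1 0 0 + M.1 1 1 : ℤ) - t) := by
      by_contra hneg
      nlinarith
    have hlt : ((M.1 0 0 + M.1 1 1 : ℤ) - t) < 1 := by nlinarith
    have hT : (2 : ℤ) < M.1 0 0 + M.1 1 1 := by
      have : (2 : ℝ) < (M.1 0 0 + M.1 1 1 : ℤ) := by nlinarith
      exact_mod_cast this
    have hT' : (3 : ℝ) ≤ (M.1 0 0 + M.1 1 1 : ℤ) := by exact_mod_cast hT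
    linarith
end

section
/- Let φ : ℂ → ℂⁿ be a nonconstant entire holomorphic map, where ℂⁿ carries its standard Hermitian (Euclidean) norm. For r > 0 set a_φ(r) = ∫_{D_r} ‖φ'(z)‖² dA(z) (the area, counted with multiplicity, of φ(D_r)), ℓ_φ(r) = ∫₀^{2π} ‖φ'(r e^{iθ})‖ · r dθ (the length of φ(∂D_r)), and the logarithmic means ma_φ(r) = ∫₀^r a_φ(t) dt/t and mℓ_φ(r) = ∫₀^r ℓ_φ(t) dt/t. Then liminf_{r → +∞} mℓ_φ(r) / ma_φ(r) = 0. -/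
open MeasureTheory

noncomputable section

/-- `a_φ(r)`: the area, counted with multiplicity, of the image of the disc of
radius `r` under the entire curve `φ`. -/
def aArea (n : ℕ) (φ : ℂ → EuclideanSpace ℂ (Fin n)) (r : ℝ) : ℝ :=
  ∫ z in Metric.ball (0 : ℂ) r, ‖deriv φ z‖ ^ 2

/-- `ℓ_φ(r)`: the length of the image of the circle of radius `r` under `φ`. -/
def lLength (n : ℕ) (φ : ℂ → EuclideanSpace ℂ (Fin n)) (r : ℝ) : ℝ :=
  ∫ θ in (0 : ℝ)..(2 * Real.pi), ‖deriv φ ((r : ℂ) * Complex.exp ((θ : ℂ) * Complex.I))‖ * r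

/-- The logarithmic mean `ma_φ(r) = ∫₀^r a_φ(t) dt/t`. -/
def maArea (n : ℕ) (φ : ℂ → EuclideanSpace ℂ (Fin n)) (r : ℝ) : ℝ :=
  ∫ t in (0 : ℝ)..r, aArea n φ t / t

/-- The logarithmic mean `mℓ_φ(r) = ∫₀^r ℓ_φ(t) dt/t`. -/
def mlLength (n : ℕ) (φ : ℂ → EuclideanSpace ℂ (Fin n)) (r : ℝ) : ℝ :=
  ∫ t in (0 : ℝ)..r, lLength n φ t / t

open Real in
theorem aux_polar (h : ℂ → ℝ) (hh : Continuous h) (r : ℝ) (hr : 0 ≤ r) :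
    ∫ z in Metric.ball (0 : ℂ) r, h z =
      ∫ t in (0 : ℝ)..r, t * ∫ θ in (0 : ℝ)..(2 * π), h ((t : ℂ) * Complex.exp ((θ : ℂ) * Complex.I)) := by
  have hcs : ∀ p : ℝ × ℝ, Complex.polarCoord.symm p =
      (p.1 : ℂ) * Complex.exp ((p.2 : ℂ) * Complex.I) := by
    intro p
    rw [Complex.polarCoord_symm_apply, Complex.exp_mul_I, Complex.ofReal_cos, Complex.ofReal_sin]
  rw [← integral_indicator Metric.isOpen_ball.measurableSet, ← Complex.integral_comp_polarCoord_symm]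
  have h1 : ∫ p in polarCoord.target,
      p.1 • (Metric.ball (0 : ℂ) r).indicator h (Complex.polarCoord.symm p) =
      ∫ p in polarCoord.target, (Set.Iio r ×ˢ (Set.univ : Set ℝ)).indicator
        (fun p : ℝ × ℝ => p.1 * h ((p.1 : ℂ) * Complex.exp ((p.2 : ℂ) * Complex.I))) p := by
    apply setIntegral_congr_fun polarCoord.open_target.measurableSet
    intro p hp
    have hp1 : 0 < p.1 := hp.1
    by_cases hpr : p.1 < r
    · have : Complex.polarCoord.symm p ∈ Metric.ball (0 : ℂ) r := by
        rw [mem_ball_zero_iff, Complex.norm_polarCoord_symm, abs_of_pos hp1]; exact hpr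
      have h2 : p ∈ (Set.Iio r ×ˢ (Set.univ : Set ℝ)) := ⟨hpr, trivial⟩
      simp only [Set.indicator_of_mem this, Set.indicator_of_mem h2, smul_eq_mul]
      rw [hcs]
    · have : Complex.polarCoord.symm p ∉ Metric.ball (0 : ℂ) r := by
        rw [mem_ball_zero_iff, Complex.norm_polarCoord_symm, abs_of_pos hp1]; exact hpr
      have h2 : p ∉ (Set.Iio r ×ˢ (Set.univ : Set ℝ)) := fun h => hpr h.1
      simp only [Set.indicator_of_notMem this, Set.indicator_of_notMem h2, smul_zero]
  rw [h1, setIntegral_indicator (measurableSet_Iio.prod MeasurableSet.univ)]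
  have h3 : polarCoord.target ∩ (Set.Iio r ×ˢ (Set.univ : Set ℝ)) = Set.Ioo 0 r ×ˢ Set.Ioo (-π) π := by
    ext p
    simp [polarCoord]
    tauto
  rw [h3, Measure.volume_eq_prod, setIntegral_prod]
  · rw [intervalIntegral.integral_of_le hr, integral_Ioc_eq_integral_Ioo]
    apply setIntegral_congr_fun measurableSet_Ioo
    intro t ht
    simp only
    rw [integral_const_mul, ← integral_Ioc_eq_integral_Ioo,
      ← intervalIntegral.integral_of_le (by linarith [pi_pos])]
    congr 1
    have hper : Function.Periodic
        (fun θ : ℝ => h ((t : ℂ) * Complex.exp ((θ : ℂ) * Complex.I))) (2 * π) := by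
      intro θ
      simp only
      congr 2
      rw [Complex.exp_eq_exp_iff_exists_int]
      exact ⟨1, by push_cast; ring⟩
    have := hper.intervalIntegral_add_eq (-π) 0
    rw [zero_add] at this
    rw [← this]
    congr 1
    ring
  · apply IntegrableOn.mono_set (t := Set.Icc 0 r ×ˢ Set.Icc (-π) π)
    · apply ContinuousOn.integrableOn_compact (isCompact_Icc.prod isCompact_Icc)
      fun_prop
    · exact Set.prod_mono Set.Ioo_subset_Icc_self Set.Ioo_subset_Icc_self

theorem aux_cs (f g : ℝ → ℝ) (a b : ℝ) (hab : a ≤ b) (hf : ContinuousOn f (Set.Icc a b))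
    (hg : ContinuousOn g (Set.Icc a b)) :
    (∫ t in a..b, f t * g t) ^ 2 ≤ (∫ t in a..b, f t ^ 2) * ∫ t in a..b, g t ^ 2 := by
  have hi : ∀ k : ℝ → ℝ, ContinuousOn k (Set.Icc a b) → IntervalIntegrable k volume a b := by
    intro k hk
    exact ContinuousOn.intervalIntegrable (by rwa [Set.uIcc_of_le hab])
  have key : ∀ x : ℝ, 0 ≤ (∫ t in a..b, g t ^ 2) * (x * x) + (2 * ∫ t in a..b, f t * g t) * x +
      ∫ t in a..b, f t ^ 2 := by
    intro x
    have e : (∫ t in a..b, g t ^ 2) * (x * x) + (2 * ∫ t in a..b, f t * g t) * x +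
      (∫ t in a..b, f t ^ 2) = ∫ t in a..b, (f t + x * g t) ^ 2 := by
      have : ∀ t, (f t + x * g t) ^ 2 = (x * x) * (g t ^ 2) + (2 * x) * (f t * g t) + f t ^ 2 := by
        intro t; ring
      simp_rw [this]
      rw [intervalIntegral.integral_add, intervalIntegral.integral_add,
        intervalIntegral.integral_const_mul, intervalIntegral.integral_const_mul]
      · ring
      all_goals apply hi; fun_prop
    rw [e]
    exact intervalIntegral.integral_nonneg hab (fun t _ => sq_nonneg _)
  have := discrim_le_zero key
  rw [discrim] at this
  nlinarith

open Filter Real in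
theorem aux_real (M N : ℝ → ℝ) (hM : Continuous M) (hN : Continuous N)
    (hM0 : ∀ t, 0 ≤ M t) (hN0 : ∀ t, 0 ≤ N t) (hNM : ∀ t, N t ^ 2 ≤ 2 * π * M t)
    (a B A L : ℝ → ℝ) (hB : Continuous B)
    (ha : ∀ r, a r = ∫ t in (0 : ℝ)..r, t * M t)
    (haB : ∀ r, a r = r * B r)
    (hA : ∀ r, A r = ∫ t in (0 : ℝ)..r, B t)
    (hL : ∀ r, L r = ∫ t in (0 : ℝ)..r, N t)
    (R : ℝ) (hR : 0 < R) (haR : 0 < a R) (ε : ℝ) (hε : 0 < ε) :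
    ∃ᶠ r in atTop, L r / A r ≤ ε := by
  have hIN : ∀ x y, IntervalIntegrable N volume x y := fun x y => hN.intervalIntegrable x y
  have hIB : ∀ x y, IntervalIntegrable B volume x y := fun x y => hB.intervalIntegrable x y
  have hIM : ∀ x y, IntervalIntegrable (fun t => t * M t) volume x y :=
    fun x y => (continuous_id.mul hM).intervalIntegrable x y
  have hamono : ∀ x y, 0 ≤ x → x ≤ y → a x ≤ a y := by
    intro x y hx hxy
    have : a y - a x = ∫ t in x..y, t * M t := by
      rw [ha, ha, intervalIntegral.integral_interval_sub_left (hIM _ _) (hIM _ _)]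
    have h2 : 0 ≤ ∫ t in x..y, t * M t :=
      intervalIntegral.integral_nonneg hxy (fun t ht => mul_nonneg (hx.trans ht.1) (hM0 t))
    linarith
  have ha0 : a 0 = 0 := by rw [ha]; simp
  have hderA : ∀ r, HasDerivAt A (B r) r := by
    intro r
    have := intervalIntegral.integral_hasDerivAt_right (hIB 0 r)
      (hB.stronglyMeasurableAtFilter _ _) hB.continuousAt
    exact this.congr_of_eventuallyEq (Eventually.of_forall hA)
  -- A tends to infinity
  have hAlow : ∀ r, R ≤ r → A R + a R * (log r - log R) ≤ A r := by
    intro r hr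
    have e : A r - A R = ∫ t in R..r, B t := by
      rw [hA, hA, intervalIntegral.integral_interval_sub_left (hIB _ _) (hIB _ _)]
    have e2 : ∫ t in R..r, a R * (1 / t) = a R * (log r - log R) := by
      rw [intervalIntegral.integral_const_mul, integral_one_div_of_pos hR (hR.trans_le hr),
        log_div (hR.trans_le hr).ne' hR.ne']
    have e3 : ∫ t in R..r, a R * (1 / t) ≤ ∫ t in R..r, B t := by
      apply intervalIntegral.integral_mono_on hr _ (hIB _ _)
      · intro t ht
        have ht0 : 0 < t := hR.trans_le ht.1
        have := hamono R t hR.le ht.1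
        rw [haB t] at this
        rw [mul_one_div, div_le_iff₀ ht0]; linarith
      · apply ContinuousOn.intervalIntegrable
        rw [Set.uIcc_of_le hr]
        apply ContinuousOn.mul continuousOn_const
        apply ContinuousOn.div continuousOn_const continuousOn_id
        intro t ht
        exact (hR.trans_le ht.1).ne'
    linarith
  have hAtop : Tendsto A atTop atTop := by
    have h1 : Tendsto (fun r => A R + a R * (log r - log R)) atTop atTop := by
      apply tendsto_atTop_add_const_left
      apply Tendsto.const_mul_atTop haR
      exact tendsto_atTop_add_const_right _ _ tendsto_log_atTop
    exact tendsto_atTop_mono' _ ((eventually_ge_atTop R).mono hAlow) h1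
  -- main inequality
  have hmain : ∀ r, 1 ≤ r → (L r - L 1) ^ 2 ≤ log r * (2 * π * a r) := by
    intro r hr
    have e : L r - L 1 = ∫ t in (1 : ℝ)..r, N t := by
      rw [hL, hL, intervalIntegral.integral_interval_sub_left (hIN _ _) (hIN _ _)]
    have hpos : ∀ t ∈ Set.Icc 1 r, 0 < t := fun t ht => lt_of_lt_of_le one_pos ht.1
    have hs : ContinuousOn (fun t : ℝ => (√t)⁻¹) (Set.Icc 1 r) := by
      apply ContinuousOn.inv₀ (by fun_prop)
      intro t ht
      exact (sqrt_pos.2 (hpos t ht)).ne'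
    have hs2 : ContinuousOn (fun t : ℝ => √t * N t) (Set.Icc 1 r) := by fun_prop
    have c := aux_cs _ _ 1 r hr hs hs2
    have e1 : ∫ t in (1 : ℝ)..r, (√t)⁻¹ * (√t * N t) = ∫ t in (1 : ℝ)..r, N t := by
      apply intervalIntegral.integral_congr
      intro t ht
      rw [Set.uIcc_of_le hr] at ht
      have := (sqrt_pos.2 (hpos t ht)).ne'
      simp only
      field_simp
    have e2 : ∫ t in (1 : ℝ)..r, ((√t)⁻¹) ^ 2 = log r := by
      have : ∫ t in (1 : ℝ)..r, ((√t)⁻¹) ^ 2 = ∫ t in (1 : ℝ)..r, 1 / t := by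
        apply intervalIntegral.integral_congr
        intro t ht
        rw [Set.uIcc_of_le hr] at ht
        simp only
        rw [inv_pow, sq_sqrt (hpos t ht).le, one_div]
      rw [this, integral_one_div_of_pos one_pos (by linarith), div_one]
    have e3 : ∫ t in (1 : ℝ)..r, (√t * N t) ^ 2 ≤ 2 * π * a r := by
      have h1 : ∫ t in (1 : ℝ)..r, (√t * N t) ^ 2 ≤ ∫ t in (1 : ℝ)..r, 2 * π * (t * M t) := by
        apply intervalIntegral.integral_mono_on hr
        · exact Continuous.intervalIntegrable (by fun_prop) _ _
        · exact Continuous.intervalIntegrable (by fun_prop) _ _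
        · intro t ht
          rw [mul_pow, sq_sqrt (hpos t ht).le]
          nlinarith [hNM t, hpos t ht]
      rw [intervalIntegral.integral_const_mul] at h1
      have h2 : ∫ t in (1 : ℝ)..r, t * M t = a r - a 1 := by
        rw [ha, ha, intervalIntegral.integral_interval_sub_left (hIM _ _) (hIM _ _)]
      have h3 : 0 ≤ a 1 := by rw [← ha0]; exact hamono 0 1 le_rfl zero_le_one
      rw [h2] at h1
      nlinarith [pi_pos]
    rw [e1, e2] at c
    rw [e]
    exact c.trans (mul_le_mul_of_nonneg_left e3 (log_nonneg hr))
  by_contra hcon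
  rw [not_frequently] at hcon
  have hL1 : 0 ≤ L 1 := by
    rw [hL]; exact intervalIntegral.integral_nonneg zero_le_one (fun t _ => hN0 t)
  obtain ⟨r0, hr0⟩ := eventually_atTop.1 ((hcon.and (hAtop.eventually_gt_atTop (2 * L 1 / ε))).and
    (eventually_ge_atTop 3))
  set c : ℝ := ε ^ 2 / (8 * π) with hc
  have hcpos : 0 < c := by positivity
  have hfacts : ∀ r, r0 ≤ r → 0 < A r ∧ 1 < r ∧ 0 < log r ∧
      c / (r * log r) ≤ B r / A r ^ 2 := by
    intro r hr
    obtain ⟨⟨h1, h2⟩, h3⟩ := hr0 r hr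
    have hA0 : 0 < A r := lt_of_le_of_lt (by positivity) h2
    have hr1 : 1 < r := by linarith
    have hlog : 0 < log r := log_pos hr1
    refine ⟨hA0, hr1, hlog, ?_⟩
    rw [not_le, lt_div_iff₀ hA0] at h1
    rw [div_lt_iff₀ hε] at h2
    have h4 : ε * A r / 2 ≤ L r - L 1 := by linarith
    have h5 : (ε * A r / 2) ^ 2 ≤ (L r - L 1) ^ 2 := by
      apply pow_le_pow_left₀ (by positivity) h4
    have h6 := h5.trans (hmain r hr1.le)
    rw [haB] at h6
    rw [div_le_div_iff₀ (by positivity) (by positivity), hc, div_mul_eq_mul_div,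
      div_le_iff₀ (by positivity)]
    nlinarith
  set g : ℝ → ℝ := fun r => (A r)⁻¹ + c * log (log r) with hg
  have hgd : ∀ r, r0 ≤ r → HasDerivAt g (-B r / A r ^ 2 + c * (r⁻¹ / log r)) r := by
    intro r hr
    obtain ⟨h1, h2, h3, h4⟩ := hfacts r hr
    exact ((hderA r).inv h1.ne').add
      (((hasDerivAt_log (by linarith : r ≠ 0)).log h3.ne').const_mul c)
  have hanti : AntitoneOn g (Set.Ici r0) := by
    apply antitoneOn_of_deriv_nonpos (convex_Ici r0)
    · exact fun r hr => (hgd r hr).continuousAt.continuousWithinAt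
    · intro r hr
      exact (hgd r (interior_subset hr)).differentiableAt.differentiableWithinAt
    · intro r hr
      have hr := interior_subset hr
      rw [(hgd r hr).deriv]
      obtain ⟨h1, h2, h3, h4⟩ := hfacts r hr
      have : c * (r⁻¹ / log r) = c / (r * log r) := by
        field_simp
      rw [this, neg_div]; linarith
  have htop : Tendsto (fun r => c * log (log r)) atTop atTop :=
    (tendsto_log_atTop.comp tendsto_log_atTop).const_mul_atTop hcpos
  obtain ⟨r, h1, h2⟩ := ((htop.eventually_gt_atTop (g r0)).and (eventually_ge_atTop r0)).exists
  have h3 : g r ≤ g r0 := hanti Set.self_mem_Ici h2 h2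
  have h4 : 0 < (A r)⁻¹ := inv_pos.2 (hfacts r h2).1
  simp only [hg] at h3 h1
  linarith

/-- Ahlfors' lemma (Lemma 3.29): for a nonconstant entire curve `φ : ℂ → ℂⁿ`,
`liminf_{r → ∞} mℓ_φ(r) / ma_φ(r) = 0`. -/
theorem stmt_15 (n : ℕ) (φ : ℂ → EuclideanSpace ℂ (Fin n))
    (hφ : Differentiable ℂ φ) (hnc : ¬ ∃ c, ∀ z, φ z = c) :
    Filter.liminf (fun r : ℝ => mlLength n φ r / maArea n φ r) Filter.atTop = 0 := by
  have hf : Continuous (deriv φ) := (hφ.contDiff (n := 1)).continuous_deriv le_rfl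
  set M : ℝ → ℝ := fun t => ∫ θ in (0 : ℝ)..(2 * Real.pi),
    ‖deriv φ ((t : ℂ) * Complex.exp ((θ : ℂ) * Complex.I))‖ ^ 2 with hMdef
  set N : ℝ → ℝ := fun t => ∫ θ in (0 : ℝ)..(2 * Real.pi),
    ‖deriv φ ((t : ℂ) * Complex.exp ((θ : ℂ) * Complex.I))‖ with hNdef
  have h2pi : (0 : ℝ) ≤ 2 * Real.pi := by positivity
  have hM : Continuous M := by
    apply intervalIntegral.continuous_parametric_intervalIntegral_of_continuous'
    fun_prop
  have hN : Continuous N := by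
    apply intervalIntegral.continuous_parametric_intervalIntegral_of_continuous'
    fun_prop
  have hM0 : ∀ t, 0 ≤ M t := fun t =>
    intervalIntegral.integral_nonneg h2pi (fun θ _ => by positivity)
  have hN0 : ∀ t, 0 ≤ N t := fun t =>
    intervalIntegral.integral_nonneg h2pi (fun θ _ => by positivity)
  have hNM : ∀ t, N t ^ 2 ≤ 2 * Real.pi * M t := by
    intro t
    have := aux_cs (fun _ => 1)
      (fun θ : ℝ => ‖deriv φ ((t : ℂ) * Complex.exp ((θ : ℂ) * Complex.I))‖) 0 (2 * Real.pi) h2pi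
      (by fun_prop) (by fun_prop)
    simpa using this
  set a : ℝ → ℝ := fun r => ∫ t in (0 : ℝ)..r, t * M t with hadef
  set B : ℝ → ℝ := fun r => r * ∫ s in (0 : ℝ)..1, s * M (r * s) with hBdef
  have hB : Continuous B := by
    apply continuous_id.mul
    apply intervalIntegral.continuous_parametric_intervalIntegral_of_continuous'
    fun_prop
  have haB : ∀ r, a r = r * B r := by
    intro r
    have := intervalIntegral.mul_integral_comp_mul_left (f := fun t => t * M t) (a := 0) (b := 1)
      (c := r)
    rw [mul_zero, mul_one] at this
    simp only [hadef, hBdef]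
    rw [← this]
    congr 1
    rw [← intervalIntegral.integral_const_mul]
    congr 1
    ext s
    ring
  have haA : ∀ r, 0 ≤ r → aArea n φ r = a r := by
    intro r hr
    exact aux_polar (fun z => ‖deriv φ z‖ ^ 2) (by fun_prop) r hr
  have hA : ∀ r, 0 ≤ r → maArea n φ r = ∫ t in (0 : ℝ)..r, B t := by
    intro r hr
    apply intervalIntegral.integral_congr
    intro t ht
    rw [Set.uIcc_of_le hr] at ht
    simp only
    rw [haA t ht.1, haB]
    rcases eq_or_ne t 0 with h | h
    · simp [h, hBdef]
    · field_simp
  have hL : ∀ r, 0 ≤ r → mlLength n φ r = ∫ t in (0 : ℝ)..r, N t := by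
    intro r hr
    apply intervalIntegral.integral_congr_ae
    refine Filter.Eventually.of_forall fun t ht => ?_
    rw [Set.uIoc_of_le hr] at ht
    rw [lLength, intervalIntegral.integral_mul_const, mul_div_assoc, div_self ht.1.ne', mul_one]
  obtain ⟨R, hR, haR⟩ : ∃ R, 0 < R ∧ 0 < a R := by
    have : ∃ z0, deriv φ z0 ≠ 0 := by
      by_contra hcon
      push Not at hcon
      exact hnc ⟨φ 0, fun z => is_const_of_deriv_eq_zero hφ hcon z 0⟩
    obtain ⟨z0, hz0⟩ := this
    refine ⟨‖z0‖ + 1, by positivity, ?_⟩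
    rw [← haA _ (by positivity)]
    have hcont : Continuous (fun z => ‖deriv φ z‖ ^ 2) := by fun_prop
    have hint : IntegrableOn (fun z => ‖deriv φ z‖ ^ 2) (Metric.ball (0 : ℂ) (‖z0‖ + 1)) :=
      (hcont.continuousOn.integrableOn_compact (isCompact_closedBall 0 (‖z0‖ + 1))).mono_set
        Metric.ball_subset_closedBall
    rw [aArea, setIntegral_pos_iff_support_of_nonneg_ae
      (Filter.Eventually.of_forall fun z => by positivity) hint]
    apply IsOpen.measure_pos
    · exact hcont.isOpen_support.inter Metric.isOpen_ball
    · exact ⟨z0, by simpa using hz0, by simp⟩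
  have key := aux_real M N hM hN hM0 hN0 hNM a B (fun r => ∫ t in (0 : ℝ)..r, B t)
    (fun r => ∫ t in (0 : ℝ)..r, N t) hB (fun _ => rfl) haB (fun _ => rfl) (fun _ => rfl) R hR haR
  have key2 : ∀ ε, 0 < ε → ∃ᶠ r in Filter.atTop, mlLength n φ r / maArea n φ r ≤ ε := by
    intro ε hε
    refine ((key ε hε).and_eventually (Filter.eventually_ge_atTop 0)).mono ?_
    rintro r ⟨h1, h2⟩
    rw [hA r h2, hL r h2]
    exact h1
  have hB0 : ∀ t, 0 ≤ t → 0 ≤ B t := fun t ht => mul_nonneg ht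
    (intervalIntegral.integral_nonneg zero_le_one fun s hs => mul_nonneg hs.1 (hM0 _))
  have hnn : ∀ᶠ r in Filter.atTop, 0 ≤ mlLength n φ r / maArea n φ r := by
    filter_upwards [Filter.eventually_ge_atTop 0] with r hr
    rw [hA r hr, hL r hr]
    exact div_nonneg (intervalIntegral.integral_nonneg hr fun t _ => hN0 t)
      (intervalIntegral.integral_nonneg hr fun t ht => hB0 t ht.1)
  apply le_antisymm
  · apply le_of_forall_pos_le_add
    intro ε hε
    rw [zero_add]
    exact Filter.liminf_le_of_frequently_le (key2 ε hε) ⟨0, by simpa using hnn⟩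
  · exact Filter.le_liminf_of_le (Filter.IsCoboundedUnder.of_frequently_le (key2 1 one_pos)) hnn
end
end

section
/- Let X be a compact topological space, f : X → X any map, u : X → ℝʳ a continuous map, λ > 1 a real number, and A an r×r real matrix such that the sequence of powers (Aᵐ)_{m ∈ ℕ} converges. Then the sequence of functions vₙ(x) = Σ_{k=0}^{n−1} λ^{−k} A^{n−k−1} u(f^{∘k}(x)) converges uniformly on X: there exists a function v : X → ℝʳ such that vₙ → v uniformly as n → ∞. -/
open Matrix

section aux
attribute [local instance] Matrix.linftyOpNormedAddCommGroup

theorem aux_bound {r : ℕ} (A : ℕ → Matrix (Fin r) (Fin r) ℝ)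
    (L : Matrix (Fin r) (Fin r) ℝ)
    (hA : Filter.Tendsto A Filter.atTop (nhds L)) :
    ∃ (e : ℕ → ℝ) (C : ℝ) (c : ℝ), Filter.Tendsto e Filter.atTop (nhds 0) ∧ (∀ n, 0 ≤ e n) ∧
      (∀ n, e n ≤ C) ∧ 0 ≤ c ∧ (∀ n w, ‖(A n).mulVec w - L.mulVec w‖ ≤ e n * ‖w‖) ∧
      (∀ w, ‖L.mulVec w‖ ≤ c * ‖w‖) := by
  have h0 : Filter.Tendsto (fun n => ‖A n - L‖) Filter.atTop (nhds 0) :=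
    tendsto_iff_norm_sub_tendsto_zero.1 hA
  obtain ⟨C, hC⟩ := h0.bddAbove_range
  refine ⟨fun n => ‖A n - L‖, C, ‖L‖, h0, fun n => norm_nonneg _, fun n => hC ⟨n, rfl⟩,
    norm_nonneg _, fun n w => ?_, fun w => Matrix.linfty_opNorm_mulVec _ _⟩
  rw [← Matrix.sub_mulVec]
  exact Matrix.linfty_opNorm_mulVec _ _

end aux

/-- Section 4.1: if `X` is compact, `u` is continuous, `λ > 1`, and the powers of
the matrix `A` converge, then the functions
`vₙ(x) = Σ_{k<n} λ^{-k} A^{n-k-1} u(f^k(x))` converge uniformly on `X`. -/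
theorem stmt_16 (X : Type*) [TopologicalSpace X] [CompactSpace X]
    (f : X → X) (r : ℕ) (u : X → (Fin r → ℝ)) (hu : Continuous u)
    (lam : ℝ) (hlam : 1 < lam) (A : Matrix (Fin r) (Fin r) ℝ)
    (L : Matrix (Fin r) (Fin r) ℝ)
    (hA : Filter.Tendsto (fun m : ℕ => A ^ m) Filter.atTop (nhds L)) :
    ∃ v : X → (Fin r → ℝ),
      TendstoUniformly
        (fun (n : ℕ) (x : X) =>
          ∑ k ∈ Finset.range n, (lam ^ k)⁻¹ • (A ^ (n - k - 1)).mulVec (u (f^[k] x)))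
        v Filter.atTop := by
  obtain ⟨e, C, c, he, he0, heC, hc, hAL, hL⟩ := aux_bound _ L hA
  obtain ⟨M, hM0, hM⟩ : ∃ M : ℝ, 0 ≤ M ∧ ∀ x, ‖u x‖ ≤ M := by
    obtain ⟨M, hM⟩ := (isCompact_range hu).isBounded.exists_norm_le
    exact ⟨max M 0, le_max_right _ _, fun x => (hM _ ⟨x, rfl⟩).trans (le_max_left _ _)⟩
  have hlp : ∀ k : ℕ, 0 < (lam ^ k)⁻¹ := fun k => by positivity
  have hgeo : Summable (fun k : ℕ => (lam ^ k)⁻¹) := by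
    simpa [inv_pow] using
      summable_geometric_of_lt_one (r := lam⁻¹) (by positivity) (inv_lt_one_of_one_lt₀ hlam)
  let D : ℕ → ℕ → ℝ := fun n k => (lam ^ k)⁻¹ * ((if k < n then e (n - k - 1) else c) * M)
  have hDle : ∀ n k, D n k ≤ (lam ^ k)⁻¹ * (max C c * M) := fun n k => by
    have : (if k < n then e (n - k - 1) else c) ≤ max C c := by
      split_ifs
      · exact (heC _).trans (le_max_left _ _)
      · exact le_max_right _ _
    have := (hlp k).le
    simp only [D]
    gcongr
  have hD0 : ∀ n k, 0 ≤ D n k := fun n k => by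
    refine mul_nonneg (hlp k).le (mul_nonneg ?_ hM0)
    split_ifs
    exacts [he0 _, hc]
  have hbs : Summable (fun k : ℕ => (lam ^ k)⁻¹ * (max C c * M)) := hgeo.mul_right _
  have hDs : ∀ n, Summable (D n) := fun n => Summable.of_nonneg_of_le (hD0 n) (hDle n) hbs
  have hDt : Filter.Tendsto (fun n => ∑' k, D n k) Filter.atTop (nhds 0) := by
    have := tendsto_tsum_of_dominated_convergence (𝓕 := Filter.atTop) (f := D)
      (g := fun _ => (0 : ℝ)) hbs
      (fun k => by
        have h1 : Filter.Tendsto (fun n : ℕ => n - k - 1) Filter.atTop Filter.atTop := by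
          simpa [Nat.sub_sub] using Filter.tendsto_sub_atTop_nat (k + 1)
        have h2 : Filter.Tendsto (fun n => (lam ^ k)⁻¹ * (e (n - k - 1) * M))
            Filter.atTop (nhds 0) := by
          simpa using ((he.comp h1).mul_const M).const_mul ((lam ^ k)⁻¹)
        refine h2.congr' ?_
        filter_upwards [Filter.eventually_gt_atTop k] with n hn
        simp [D, hn])
      (Filter.Eventually.of_forall fun n k => by
        rw [Real.norm_of_nonneg (hD0 n k)]; exact hDle n k)
    simpa using this
  have hvs : ∀ x, Summable (fun k : ℕ => (lam ^ k)⁻¹ • L.mulVec (u (f^[k] x))) := fun x => by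
    refine Summable.of_norm_bounded (hgeo.mul_right (c * M)) fun k => ?_
    rw [norm_smul, Real.norm_of_nonneg (hlp k).le]
    exact mul_le_mul_of_nonneg_left
      ((hL _).trans (mul_le_mul_of_nonneg_left (hM _) hc)) (hlp k).le
  refine ⟨fun x => ∑' k : ℕ, (lam ^ k)⁻¹ • L.mulVec (u (f^[k] x)), ?_⟩
  rw [Metric.tendstoUniformly_iff]
  intro ε hε
  filter_upwards [hDt.eventually (gt_mem_nhds hε)] with n hn x
  refine lt_of_le_of_lt ?_ hn
  let g : ℕ → (Fin r → ℝ) := fun k =>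
    if k < n then (lam ^ k)⁻¹ • (A ^ (n - k - 1)).mulVec (u (f^[k] x)) else 0
  have hg0 : ∀ k ∉ Finset.range n, g k = 0 := fun k hk => by
    simp only [Finset.mem_range] at hk
    simp [g, hk]
  have hgs : Summable g := summable_of_ne_finset_zero hg0
  have hsum : ∑ k ∈ Finset.range n, (lam ^ k)⁻¹ • (A ^ (n - k - 1)).mulVec (u (f^[k] x))
      = ∑' k, g k := by
    rw [tsum_eq_sum hg0]
    refine Finset.sum_congr rfl fun k hk => ?_
    simp only [Finset.mem_range] at hk
    simp [g, hk]
  rw [hsum, dist_comm, dist_eq_norm, ← hgs.tsum_sub (hvs x)]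
  refine tsum_of_norm_bounded (hDs n).hasSum fun k => ?_
  by_cases hk : k < n
  · simp only [g, D, hk, if_true]
    rw [← smul_sub, norm_smul, Real.norm_of_nonneg (hlp k).le]
    exact mul_le_mul_of_nonneg_left
      ((hAL _ _).trans (mul_le_mul_of_nonneg_left (hM _) (he0 _))) (hlp k).le
  · simp only [g, D, hk, if_false]
    rw [zero_sub, norm_neg, norm_smul, Real.norm_of_nonneg (hlp k).le]
    exact mul_le_mul_of_nonneg_left
      ((hL _).trans (mul_le_mul_of_nonneg_left (hM _) hc)) (hlp k).le
end

section
/- Let A ∈ M₂(ℤ) be a matrix with det A = 1 or det A = −1 (so A induces an automorphism of the lattice ℤ²). Suppose that, as a real matrix, A has an eigenvalue λ > 1 with eigenvector v⁺ ∈ ℝ² and the eigenvalue λ⁻¹ with eigenvector v⁻ ∈ ℝ², where v⁺ and v⁻ are linearly independent. Let C = {a·v⁺ + b·v⁻ : a > 0, b > 0} be the open convex cone bounded by the two eigenrays (note that A maps C onto itself). Then there exist finitely many lattice points θ₁, …, θ_r ∈ C ∩ ℤ² such that every lattice point θ ∈ C ∩ ℤ² can be written as θ = Aⁿ(m₁θ₁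 + ⋯ + m_rθ_r) for some integer n ∈ ℤ and some nonnegative integers m₁, …, m_r. -/
open Matrix

def PP (vp vm : Fin 2 → ℝ) (w : Fin 2 → ℤ) (a b : ℝ) : Prop :=
  (fun j => ((w j : ℝ))) = a • vp + b • vm

lemma PP_step {vp vm : Fin 2 → ℝ} {M : Matrix (Fin 2) (Fin 2) ℤ} {μ ν : ℝ}
    (h1 : (M.map ((↑) : ℤ → ℝ)).mulVec vp = μ • vp)
    (h2 : (M.map ((↑) : ℤ → ℝ)).mulVec vm = ν • vm)
    {w : Fin 2 → ℤ} {a b : ℝ} (h : PP vp vm w a b) :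
    PP vp vm (M.mulVec w) (μ * a) (ν * b) := by
  unfold PP at *
  have : (fun j => ((M.mulVec w j : ℤ) : ℝ))
      = (M.map ((↑) : ℤ → ℝ)).mulVec (fun j => (w j : ℝ)) := by
    ext j
    simp [Matrix.mulVec, dotProduct]
  rw [this, h, Matrix.mulVec_add, Matrix.mulVec_smul, Matrix.mulVec_smul, h1, h2,
    smul_smul, smul_smul, mul_comm a, mul_comm b]

lemma PP_pow {vp vm : Fin 2 → ℝ} {M : Matrix (Fin 2) (Fin 2) ℤ} {μ ν : ℝ}
    (h1 : (M.map ((↑) : ℤ → ℝ)).mulVec vp = μ • vp)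
    (h2 : (M.map ((↑) : ℤ → ℝ)).mulVec vm = ν • vm)
    {w : Fin 2 → ℤ} {a b : ℝ} (h : PP vp vm w a b) (k : ℕ) :
    PP vp vm ((M ^ k).mulVec w) (μ ^ k * a) (ν ^ k * b) := by
  induction k with
  | zero => simpa using h
  | succ k ih =>
    have := PP_step h1 h2 ih
    rwa [Matrix.mulVec_mulVec, ← pow_succ', ← mul_assoc, ← mul_assoc, ← pow_succ',
      ← pow_succ'] at this

lemma inv_eig {A B : Matrix (Fin 2) (Fin 2) ℤ} (hBA : B * A = 1) {v : Fin 2 → ℝ} {μ : ℝ}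
    (hμ : μ ≠ 0) (h : (A.map ((↑) : ℤ → ℝ)).mulVec v = μ • v) :
    (B.map ((↑) : ℤ → ℝ)).mulVec v = μ⁻¹ • v := by
  have e : B.map ((↑) : ℤ → ℝ) * A.map ((↑) : ℤ → ℝ) = 1 := by
    have := congrArg (Int.castRingHom ℝ).mapMatrix hBA
    rw [map_mul, map_one] at this
    exact this
  have h3 := congrArg (fun u => (B.map ((↑) : ℤ → ℝ)).mulVec u) h
  simp only [Matrix.mulVec_mulVec, e, Matrix.one_mulVec, Matrix.mulVec_smul] at h3
  rw [eq_inv_smul_iff₀ hμ]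
  exact h3.symm

def SS (vp vm : Fin 2 → ℝ) (K : ℝ) : Set (Fin 2 → ℤ) :=
  {w | ∃ a b : ℝ, 0 < a ∧ 0 < b ∧ a ≤ K ∧ b ≤ K ∧ PP vp vm w a b}

lemma SS_finite (vp vm : Fin 2 → ℝ) (K : ℝ) : (SS vp vm K).Finite := by
  apply (Set.finite_Icc (fun j => -⌈K * (|vp j| + |vm j|)⌉)
    (fun j => ⌈K * (|vp j| + |vm j|)⌉)).subset
  rintro w ⟨a, b, ha, hb, haK, hbK, h⟩
  have key : ∀ j, |w j| ≤ ⌈K * (|vp j| + |vm j|)⌉ := by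
    intro j
    have hj : (w j : ℝ) = a * vp j + b * vm j := by
      have := congrFun h j
      simpa using this
    have : ((|w j| : ℤ) : ℝ) ≤ ⌈K * (|vp j| + |vm j|)⌉ := by
      refine le_trans ?_ (Int.le_ceil _)
      rw [Int.cast_abs, hj]
      refine (abs_add_le _ _).trans ?_
      rw [abs_mul, abs_mul, abs_of_pos ha, abs_of_pos hb, mul_add]
      gcongr
    exact_mod_cast this
  exact ⟨fun j => (abs_le.mp (key j)).1, fun j => (abs_le.mp (key j)).2⟩

lemma key_span {A : Matrix (Fin 2) (Fin 2) ℤ} {lam : ℝ} (hlam : 1 < lam) {vp vm : Fin 2 → ℝ}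
    (hvp : (A.map ((↑) : ℤ → ℝ)).mulVec vp = lam • vp)
    (hvm : (A.map ((↑) : ℤ → ℝ)).mulVec vm = lam⁻¹ • vm)
    {w0 : Fin 2 → ℤ} {a0 b0 : ℝ} (ha0 : 0 < a0) (hb0 : 0 < b0) (h0 : PP vp vm w0 a0 b0)
    {w : Fin 2 → ℤ} {a b : ℝ} (h : PP vp vm w a b)
    (h1 : b / b0 ≤ a / a0) (h2 : a / a0 ≤ lam ^ 2 * (b / b0)) :
    w ∈ Submodule.span ℕ (SS vp vm (a0 + lam * a0 + b0 + lam⁻¹ * b0)) := by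
  have hl0 : 0 < lam := by linarith
  have hli : 0 < lam⁻¹ := by positivity
  have hli1 : lam⁻¹ < 1 := inv_lt_one_of_one_lt₀ hlam
  have hll : lam * lam⁻¹ = 1 := mul_inv_cancel₀ hl0.ne'
  have hA := PP_step hvp hvm h0
  have pa : 0 < lam * a0 := by positivity
  have pb : 0 < lam⁻¹ * b0 := by positivity
  set K := a0 + lam * a0 + b0 + lam⁻¹ * b0 with hK
  have m0 : w0 ∈ SS vp vm K := ⟨a0, b0, ha0, hb0, by linarith, by linarith, h0⟩
  have m1 : A.mulVec w0 ∈ SS vp vm K :=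
    ⟨lam * a0, lam⁻¹ * b0, pa, pb, by linarith, by linarith, hA⟩
  set x := a / a0 with hx
  set y := b / b0 with hy
  have hxa : a = x * a0 := by rw [hx]; field_simp
  have hyb : b = y * b0 := by rw [hy]; field_simp
  set d := lam - lam⁻¹ with hd
  have hdpos : 0 < d := by linarith
  obtain ⟨t, ht⟩ : ∃ t, t = (x - y) / d := ⟨_, rfl⟩
  obtain ⟨s, hs⟩ : ∃ s, s = (lam * y - lam⁻¹ * x) / d := ⟨_, rfl⟩
  have ht0 : 0 ≤ t := by rw [ht]; exact div_nonneg (by linarith) hdpos.le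
  have hs0 : 0 ≤ s := by
    rw [hs]
    refine div_nonneg ?_ hdpos.le
    have : lam⁻¹ * x ≤ lam⁻¹ * (lam ^ 2 * y) := by gcongr
    have e : lam⁻¹ * (lam ^ 2 * y) = lam * y := by field_simp
    linarith
  have htd : t * d = x - y := by rw [ht]; field_simp
  have hsd : s * d = lam * y - lam⁻¹ * x := by rw [hs]; field_simp
  have ex : s + lam * t = x := by
    apply mul_right_cancel₀ hdpos.ne'
    linear_combination hsd + lam * htd + x * (-hd)
  have ey : s + lam⁻¹ * t = y := by
    apply mul_right_cancel₀ hdpos.ne'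
    linear_combination hsd + lam⁻¹ * htd + y * (-hd)
  obtain ⟨p, hp⟩ : ∃ p, p = ⌊s⌋₊ := ⟨_, rfl⟩
  obtain ⟨q, hq⟩ : ∃ q, q = ⌊t⌋₊ := ⟨_, rfl⟩
  have hp1 : (p : ℝ) ≤ s := by rw [hp]; exact Nat.floor_le hs0
  have hp2 : s < p + 1 := by rw [hp]; exact Nat.lt_floor_add_one s
  have hq1 : (q : ℝ) ≤ t := by rw [hq]; exact Nat.floor_le ht0
  have hq2 : t < q + 1 := by rw [hq]; exact Nat.lt_floor_add_one t
  obtain ⟨s', hs'⟩ : ∃ s', s' = s - p := ⟨_, rfl⟩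
  obtain ⟨t', ht'⟩ : ∃ t', t' = t - q := ⟨_, rfl⟩
  set r := w - p • w0 - q • A.mulVec w0 with hr
  have hPr : PP vp vm r (s' * a0 + t' * (lam * a0)) (s' * b0 + t' * (lam⁻¹ * b0)) := by
    unfold PP at *
    ext j
    have e0 := congrFun h0 j
    have e1 := congrFun hA j
    have e2 := congrFun h j
    simp only [Pi.add_apply, Pi.smul_apply, smul_eq_mul] at e0 e1 e2
    simp only [hr, Pi.add_apply, Pi.sub_apply, Pi.smul_apply, smul_eq_mul, nsmul_eq_mul]
    push_cast
    simp only [Pi.mul_apply, Pi.natCast_apply, Int.cast_mul, Int.cast_natCast]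
    rw [e0, e1, e2, hxa, hyb, ← ex, ← ey, hs', ht']
    ring
  have hw : w = r + p • w0 + q • A.mulVec w0 := by rw [hr]; abel
  have hrm : r ∈ Submodule.span ℕ (SS vp vm K) := by
    have s0 : 0 ≤ s' := by linarith
    have t0 : 0 ≤ t' := by linarith
    have s1 : s' ≤ 1 := by linarith
    have t1 : t' ≤ 1 := by linarith
    have B1 : s' * a0 ≤ a0 := mul_le_of_le_one_left ha0.le s1
    have B2 : s' * b0 ≤ b0 := mul_le_of_le_one_left hb0.le s1
    have B3 : t' * (lam * a0) ≤ lam * a0 := mul_le_of_le_one_left pa.le t1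
    have B4 : t' * (lam⁻¹ * b0) ≤ lam⁻¹ * b0 := mul_le_of_le_one_left pb.le t1
    by_cases hz : s' = 0 ∧ t' = 0
    · have : r = 0 := by
        ext j
        have := congrFun hPr j
        simpa [hz.1, hz.2] using this
      rw [this]; exact zero_mem _
    · apply Submodule.subset_span
      refine ⟨_, _, ?_, ?_, ?_, ?_, hPr⟩
      · rcases s0.lt_or_eq with h' | h'
        · positivity
        · have : 0 < t' := lt_of_le_of_ne t0 fun h'' => hz ⟨h'.symm, h''.symm⟩
          positivity
      · rcases s0.lt_or_eq with h' | h'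
        · positivity
        · have : 0 < t' := lt_of_le_of_ne t0 fun h'' => hz ⟨h'.symm, h''.symm⟩
          positivity
      · linarith
      · linarith
  rw [hw]
  exact add_mem (add_mem hrm (nsmul_mem (Submodule.subset_span m0) _))
    (nsmul_mem (Submodule.subset_span m1) _)

/-- Lemma 7.19 (abstracted to the lattice `ℤ²`): if `A ∈ M₂(ℤ)` with `det A = ±1`
has real eigenvalues `λ > 1` and `λ⁻¹` with independent eigenvectors `v⁺`, `v⁻`,
then there are finitely many lattice points `θ₁, …, θ_r` in the open cone
`C = {a·v⁺ + b·v⁻ : a, b > 0}` such that every lattice point `θ ∈ C` can be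
written `θ = Aⁿ(m₁θ₁ + ⋯ + m_rθ_r)` with `n ∈ ℤ` and `mᵢ ∈ ℕ` (since `A` is
invertible over `ℤ`, this is expressed as `A^{n₁} θ = A^{n₂} (Σ mᵢθᵢ)` with
`n₁, n₂ ∈ ℕ`). -/
theorem stmt_18 (A : Matrix (Fin 2) (Fin 2) ℤ) (hdet : A.det = 1 ∨ A.det = -1)
    (lam : ℝ) (hlam : 1 < lam) (vp vm : Fin 2 → ℝ)
    (hvp : (A.map ((↑) : ℤ → ℝ)).mulVec vp = lam • vp)
    (hvm : (A.map ((↑) : ℤ → ℝ)).mulVec vm = lam⁻¹ • vm)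
    (hind : LinearIndependent ℝ ![vp, vm]) :
    ∃ (r : ℕ) (θ : Fin r → (Fin 2 → ℤ)),
      (∀ i, ∃ a b : ℝ, 0 < a ∧ 0 < b ∧ (fun j => ((θ i j : ℝ))) = a • vp + b • vm) ∧
      ∀ w : Fin 2 → ℤ,
        (∃ a b : ℝ, 0 < a ∧ 0 < b ∧ (fun j => ((w j : ℝ))) = a • vp + b • vm) →
        ∃ (n₁ n₂ : ℕ) (m : Fin r → ℕ),
          (A ^ n₁).mulVec w = (A ^ n₂).mulVec (∑ i, m i • θ i) := by
  by_cases hne : ∃ w0 : Fin 2 → ℤ, ∃ a b : ℝ, 0 < a ∧ 0 < b ∧ PP vp vm w0 a b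
  swap
  · refine ⟨0, Fin.elim0, fun i => i.elim0, ?_⟩
    rintro w ⟨a, b, ha, hb, h⟩
    exact absurd ⟨w, a, b, ha, hb, h⟩ hne
  obtain ⟨w0, a0, b0, ha0, hb0, h0⟩ := hne
  have hl0 : 0 < lam := by linarith
  have hu : IsUnit A.det := by rcases hdet with h | h <;> simp [h]
  have hBA : A⁻¹ * A = 1 := Matrix.nonsing_inv_mul A hu
  have hAB : A * A⁻¹ = 1 := Matrix.mul_nonsing_inv A hu
  obtain ⟨B, hB⟩ : ∃ B, B = A⁻¹ := ⟨_, rfl⟩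
  rw [← hB] at hBA hAB
  have hBp := inv_eig hBA hl0.ne' hvp
  have hBm := inv_eig hBA (inv_ne_zero hl0.ne') hvm
  rw [inv_inv] at hBm
  obtain ⟨r, θ, -, hθ⟩ :=
    (SS_finite vp vm (a0 + lam * a0 + b0 + lam⁻¹ * b0)).fin_param
  refine ⟨r, θ, ?_, ?_⟩
  · intro i
    have : θ i ∈ SS vp vm (a0 + lam * a0 + b0 + lam⁻¹ * b0) := hθ ▸ Set.mem_range_self i
    obtain ⟨a, b, ha, hb, -, -, h⟩ := this
    exact ⟨a, b, ha, hb, h⟩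
  rintro w ⟨a, b, ha, hb, h⟩
  have h : PP vp vm w a b := h
  have hx : 0 < a / a0 := by positivity
  have hy : 0 < b / b0 := by positivity
  obtain ⟨n, hn1, hn2⟩ := exists_mem_Ico_zpow (div_pos hx hy)
    (show 1 < lam ^ 2 from one_lt_pow₀ hlam two_ne_zero)
  rw [le_div_iff₀ hy] at hn1
  rw [div_lt_iff₀ hy, zpow_add_one₀ (by positivity)] at hn2
  have fin : ∀ z : Fin 2 → ℤ,
      z ∈ Submodule.span ℕ (SS vp vm (a0 + lam * a0 + b0 + lam⁻¹ * b0)) →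
      ∃ m : Fin r → ℕ, ∑ i, m i • θ i = z := by
    intro z hz
    rw [← hθ] at hz
    exact (Submodule.mem_span_range_iff_exists_fun ℕ).1 hz
  obtain ⟨k, rfl | rfl⟩ := Int.eq_nat_or_neg n
  · rw [zpow_natCast] at hn1 hn2
    have hz := PP_pow hBp hBm h k
    have hlk : 0 < lam ^ k := by positivity
    have e : lam⁻¹ ^ k * a / a0 = (lam ^ k)⁻¹ * (a / a0) := by rw [inv_pow]; ring
    have e' : lam ^ k * b / b0 = (lam ^ k)⁻¹ * ((lam ^ 2) ^ k * (b / b0)) := by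
      rw [← pow_mul, mul_comm 2 k, pow_mul]; field_simp
    have hlki : 0 ≤ (lam ^ k)⁻¹ := by positivity
    obtain ⟨m, hm⟩ := fin _ (key_span hlam hvp hvm ha0 hb0 h0 hz
      (by rw [e, e']; exact mul_le_mul_of_nonneg_left hn1 hlki)
      (by rw [e, e']
          have := mul_le_mul_of_nonneg_left hn2.le hlki
          linarith))
    refine ⟨0, k, m, ?_⟩
    have hc : Commute A B := by rw [Commute, SemiconjBy, hAB, hBA]
    rw [hm, Matrix.mulVec_mulVec, ← hc.mul_pow, hAB]
    simp
  · rw [_root_.zpow_neg, zpow_natCast] at hn1 hn2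
    have hz := PP_pow hvp hvm h k
    have hlk : 0 < lam ^ k := by positivity
    have e : lam ^ k * a / a0 = (lam ^ k) * (a / a0) := by ring
    have e' : lam⁻¹ ^ k * b / b0 = (lam ^ k) * (((lam ^ 2) ^ k)⁻¹ * (b / b0)) := by
      rw [← pow_mul, mul_comm 2 k, pow_mul, inv_pow]; field_simp
    obtain ⟨m, hm⟩ := fin _ (key_span hlam hvp hvm ha0 hb0 h0 hz
      (by rw [e, e']; exact mul_le_mul_of_nonneg_left hn1 hlk.le)
      (by rw [e, e']
          have := mul_le_mul_of_nonneg_left hn2.le hlk.le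
          linarith))
    refine ⟨k, 0, m, ?_⟩
    rw [hm]
    simp
end

section
/- Let d ≥ 2 be an integer and let P be a homogeneous polynomial of degree d in three variables with real coefficients that is geometrically irreducible, i.e. P remains irreducible in ℂ[x₀, x₁, x₂]. Then there exists a real projective line meeting the plane curve {P = 0} ⊂ ℙ² in at most d − 2 real points counted with multiplicity. Concretely: there exists an injective linear map ι : ℝ² → ℝ³ such that the binary form Q = P ∘ ι is nonzero (hence homogeneous of degree d) and Q is not a product of linear forms over ℝ — equivalently, Q has a non-real projective root, so that among its d projective roots in ℙ¹(ℂ), counted with multiplicity, at most d − 2 are real. -/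
noncomputable section

/-- The binary form `Q = P ∘ ι` obtained by restricting a polynomial `P` in three
variables along a linear map `ι : ℝ² → ℝ³` (substituting the linear forms given by
the coordinates of `ι` into `P`). -/
def restrictLine (ι : (Fin 2 → ℝ) →ₗ[ℝ] (Fin 3 → ℝ)) (P : MvPolynomial (Fin 3) ℝ) :
    MvPolynomial (Fin 2) ℝ :=
  MvPolynomial.aeval
    (fun i : Fin 3 => ∑ j : Fin 2, MvPolynomial.C (ι (Pi.single j 1) i) * MvPolynomial.X j) P


open MvPolynomial in
theorem aux_eval (F : MvPolynomial (Fin 3) ℂ) (g : Fin 3 → MvPolynomial (Fin 3) ℂ)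
    (x : Fin 3 → ℂ) : eval x (aeval g F) = eval (fun k => eval x (g k)) F := by
  induction F using MvPolynomial.induction_on with
  | C a => simp
  | add p q hp hq => simp_all
  | mul_X p n hp => simp_all

open MvPolynomial in
theorem aux_plane (d : ℕ) (hd : 2 ≤ d) (F : MvPolynomial (Fin 3) ℂ) (hF : F.IsHomogeneous d)
    (hirr : Irreducible F) (u : Fin 3 → ℂ) (i : Fin 3) (hu : u i ≠ 0)
    (hv : ∀ x : Fin 3 → ℂ, ∑ j, u j * x j = 0 → eval x F = 0) : False := by
  set l : MvPolynomial (Fin 3) ℂ := ∑ j, C (u j) * X j with hl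
  set g : Fin 3 → MvPolynomial (Fin 3) ℂ :=
    fun k => X k - C (if k = i then (u i)⁻¹ else 0) * l with hg
  have h0 : aeval g F = 0 := by
    apply MvPolynomial.funext
    intro x
    have h1 : eval x (aeval g F) = eval (fun k => eval x (g k)) F := by
      exact aux_eval F g x
    rw [h1, map_zero]
    apply hv
    have h2 : ∀ k, eval x (g k) = x k - (if k = i then (u i)⁻¹ else 0) * ∑ j, u j * x j := by
      intro k; simp [hg, hl, map_sum]
    simp only [h2, mul_sub, Finset.sum_sub_distrib]
    simp [hu]
  have h3 : l ∣ F := by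
    rw [← Ideal.mem_span_singleton, ← Ideal.Quotient.eq_zero_iff_mem]
    have h4 : Ideal.Quotient.mkₐ ℂ (Ideal.span {l}) (aeval g F) =
        Ideal.Quotient.mkₐ ℂ (Ideal.span {l}) F := by
      have : (Ideal.Quotient.mkₐ ℂ (Ideal.span {l})).comp (aeval g) =
          Ideal.Quotient.mkₐ ℂ (Ideal.span {l}) := by
        apply MvPolynomial.algHom_ext
        intro k
        simp only [AlgHom.comp_apply, aeval_X, Ideal.Quotient.mkₐ_eq_mk]
        rw [Ideal.Quotient.eq, Ideal.mem_span_singleton]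
        refine ⟨-C (if k = i then (u i)⁻¹ else 0), ?_⟩
        simp only [hg]; ring
      exact DFunLike.congr_fun this F
    rw [h0, map_zero] at h4
    exact h4.symm
  obtain ⟨G, hG⟩ := h3
  have hlh : l.IsHomogeneous 1 := by
    apply IsHomogeneous.sum
    intro j _
    exact isHomogeneous_C_mul_X _ _
  rcases hirr.isUnit_or_isUnit hG with h | h
  · have := h.map (eval (0 : Fin 3 → ℂ))
    simp [hl] at this
  · obtain ⟨c, -, rfl⟩ := MvPolynomial.isUnit_iff_eq_C_of_isReduced.1 h
    have h5 : F.IsHomogeneous 1 := by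
      rw [hG]
      simpa using hlh.mul (isHomogeneous_C (Fin 3) c)
    have := hF.inj_right h5 hirr.ne_zero
    omega

theorem aux_uni (q : Polynomial ℂ) : (∃ r, q.eval r = 0) ∨ ∀ t, q.eval t = q.eval 0 := by
  by_cases h : q.degree = 0
  · right
    intro t
    rw [Polynomial.eq_C_of_degree_eq_zero h]; simp
  · left
    exact IsAlgClosed.exists_root q h

theorem aux_cont (f g : ℝ → ℂ) (hf : Continuous f) (hg : Continuous g)
    (h : ∀ e, e ≠ 0 → f e = g e) : f 0 = g 0 := by
  have := Continuous.ext_on (dense_compl_singleton (0 : ℝ)) hf hg (fun x hx => h x hx)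
  rw [this]

open MvPolynomial in
theorem aux_line (F : MvPolynomial (Fin 3) ℂ) (g : Fin 3 → Polynomial ℂ) :
    (∃ r, eval (fun i => (g i).eval r) F = 0) ∨
      ∀ t, eval (fun i => (g i).eval t) F = eval (fun i => (g i).eval 0) F := by
  have h : ∀ r, (aeval g F).eval r = eval (fun i => (g i).eval r) F := by
    intro r
    induction F using MvPolynomial.induction_on with
    | C a => simp
    | add p q hp hq => simp_all
    | mul_X p n hp => simp_all
  simpa only [h] using aux_uni (aeval g F)

open MvPolynomial in
theorem aux_hom (d : ℕ) (F : MvPolynomial (Fin 3) ℂ) (hF : F.IsHomogeneous d) (s : ℂ)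
    (x : Fin 3 → ℂ) : eval (fun i => s * x i) F = s ^ d * eval x F := by
  simp only [eval_eq, Finset.mul_sum]
  refine Finset.sum_congr rfl fun m hm => ?_
  have h1 := hF (mem_support_iff.1 hm)
  rw [Finsupp.weight_apply] at h1
  simp only [mul_pow, Finset.prod_mul_distrib, Finset.prod_pow_eq_pow_sum]
  have : ∑ i ∈ m.support, m i = d := by
    rw [← h1]; simp [Finsupp.sum]
  rw [this]; ring

open MvPolynomial in
theorem aux_point (d : ℕ) (hd : 2 ≤ d) (F : MvPolynomial (Fin 3) ℂ) (hF : F.IsHomogeneous d)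
    (hirr : Irreducible F) : ∃ w t : ℂ, w.im ≠ 0 ∧ eval ![w, 1, t] F = 0 := by
  by_contra! hc
  have key : ∀ f : ℝ → Fin 3 → ℂ, Continuous f → Continuous fun e => eval (f e) F :=
    fun f hf => (MvPolynomial.continuous_eval F).comp hf
  have h1 : ∀ w t : ℂ, w.im ≠ 0 → eval ![w, 1, t] F = eval ![w, 1, 0] F := by
    intro w t hw
    have e : ∀ r : ℂ, (fun i => Polynomial.eval r
        ((![Polynomial.C w, 1, Polynomial.X] : Fin 3 → Polynomial ℂ) i)) = ![w, 1, r] := by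
      intro r; ext i; fin_cases i <;> simp
    have := aux_line F ![Polynomial.C w, 1, Polynomial.X]
    simp only [e] at this
    rcases this with ⟨r, hr⟩ | h
    · exact absurd hr (hc w r hw)
    · exact h t
  have h2 : ∀ w t : ℂ, eval ![w, 1, t] F = eval ![w, 1, 0] F := by
    intro w t
    by_cases hw : w.im = 0
    · have := aux_cont (fun e => eval ![w + e * Complex.I, 1, t] F)
        (fun e => eval ![w + e * Complex.I, 1, 0] F)
        (key _ (by fun_prop)) (key _ (by fun_prop))
        (fun e he => h1 _ _ (by simp [hw, he]))
      simpa using this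
    · exact h1 w t hw
  have e : ∀ r : ℂ, (fun i => Polynomial.eval r
      ((![Polynomial.X, 1, 0] : Fin 3 → Polynomial ℂ) i)) = ![r, 1, 0] := by
    intro r; ext i; fin_cases i <;> simp
  have h3 := aux_line F ![Polynomial.X, 1, 0]
  simp only [e] at h3
  have hs : ∀ w s t : ℂ, s ≠ 0 → eval ![s * w, s, t] F = s ^ d * eval ![w, 1, 0] F := by
    intro w s t hs
    rw [← h2 w (t / s), ← aux_hom d F hF]
    congr 2
    ext i; fin_cases i <;> simp [mul_div_cancel₀, hs]
  rcases h3 with ⟨r, hr⟩ | h3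
  · refine aux_plane d hd F hF hirr ![1, -r, 0] 0 (by simp) ?_
    intro x hx
    simp [Fin.sum_univ_three] at hx
    have hx' : x = ![x 1 * r, x 1, x 2] := by
      ext i; fin_cases i <;> simp
      linear_combination hx
    rw [hx']
    by_cases h : x 1 = 0
    · have := aux_cont (fun e => eval ![e * r, (e : ℂ), x 2] F) (fun e => 0)
        (key _ (by fun_prop)) (by fun_prop)
        (fun e he => by rw [hs _ _ _ (by simpa using he), hr, mul_zero])
      simpa [h] using this
    · rw [hs _ _ _ h, hr, mul_zero]
  · refine aux_plane d hd F hF hirr ![0, 1, 0] 1 (by simp) ?_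
    intro x hx
    simp [Fin.sum_univ_three] at hx
    have hx' : x = ![x 0, 0, x 2] := by
      ext i; fin_cases i <;> simp [hx]
    rw [hx']
    have := aux_cont (fun e => eval ![x 0, (e : ℂ), x 2] F)
      (fun e => (e : ℂ) ^ d * eval ![0, 1, 0] F)
      (key _ (by fun_prop)) (by fun_prop)
      (fun e he => by
        have he' : (e : ℂ) ≠ 0 := by simpa using he
        have := hs (x 0 / e) e (x 2) he'
        rw [mul_div_cancel₀ _ he', h3] at this
        exact this)
    simpa [show d ≠ 0 by omega] using this

theorem aux_restrict (ι : (Fin 2 → ℝ) →ₗ[ℝ] (Fin 3 → ℝ)) (P : MvPolynomial (Fin 3) ℝ) (s t : ℂ) :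
    MvPolynomial.eval ![s, t] (MvPolynomial.map (algebraMap ℝ ℂ) (restrictLine ι P)) =
    MvPolynomial.eval (fun i => (ι (Pi.single 0 1) i : ℂ) * s + (ι (Pi.single 1 1) i : ℂ) * t)
      (MvPolynomial.map (algebraMap ℝ ℂ) P) := by
  unfold restrictLine
  induction P using MvPolynomial.induction_on with
  | C a => simp
  | add p q hp hq => simp_all
  | mul_X p n hp => simp_all [Fin.sum_univ_two]

/-- Lemma 5.3 for plane curves: a geometrically irreducible real plane curve of
degree `d ≥ 2` admits a real line on which the restricted binary form `Q` is
nonzero and has a non-real projective root (hence at most `d - 2` real roots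
counted with multiplicity). The point `[s : t] ∈ ℙ¹(ℂ)` is non-real exactly when
`s·conj t ∉ ℝ`. -/
theorem stmt_19 (d : ℕ) (hd : 2 ≤ d) (P : MvPolynomial (Fin 3) ℝ)
    (hhom : P.IsHomogeneous d)
    (hirr : Irreducible (MvPolynomial.map (algebraMap ℝ ℂ) P)) :
    ∃ ι : (Fin 2 → ℝ) →ₗ[ℝ] (Fin 3 → ℝ), Function.Injective ι ∧
      restrictLine ι P ≠ 0 ∧
      ∃ s t : ℂ,
        MvPolynomial.eval ![s, t] (MvPolynomial.map (algebraMap ℝ ℂ) (restrictLine ι P)) = 0 ∧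
        (s * (starRingEnd ℂ) t).im ≠ 0 := by
  have hF := hhom.map (algebraMap ℝ ℂ)
  obtain ⟨w, t, hw, h0⟩ := aux_point d hd _ hF hirr
  let ι : (Fin 2 → ℝ) →ₗ[ℝ] (Fin 3 → ℝ) :=
    Fintype.linearCombination ℝ ![![w.re, 1, t.re], ![w.im, 0, t.im]]
  have e0 : ι (Pi.single 0 1) = ![w.re, 1, t.re] := by
    simp [ι, Fintype.linearCombination_apply_single]
  have e1 : ι (Pi.single 1 1) = ![w.im, 0, t.im] := by
    simp [ι, Fintype.linearCombination_apply_single]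
  have hev := aux_restrict ι P
  rw [e0, e1] at hev
  refine ⟨ι, ?_, ?_, 1, Complex.I, ?_, ?_⟩
  · rw [← LinearMap.ker_eq_bot, LinearMap.ker_eq_bot']
    intro m hm
    have m1 := congr_fun hm 1
    have m0 := congr_fun hm 0
    simp [ι, Fintype.linearCombination_apply, Fin.sum_univ_two] at m0 m1
    simp [m1, hw] at m0
    ext i; fin_cases i <;> simp [m0, m1]
  · intro hQ
    rw [hQ] at hev
    have hw' : (w.im : ℂ) ≠ 0 := by exact_mod_cast hw
    refine aux_plane d hd _ hF hirr
      ![(t.im : ℂ), t.re * w.im - w.re * t.im, - w.im] 2 (by simpa using hw) ?_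
    intro x hx
    simp [Fin.sum_univ_three] at hx
    have := hev (x 1) ((x 0 - x 1 * w.re) / w.im)
    rw [map_zero, map_zero] at this
    rw [this]
    congr 2
    ext i; fin_cases i
    · simp; field_simp; ring
    · simp
    · simp; field_simp; linear_combination -hx
  · rw [hev, ← h0]
    congr 2
    ext i; fin_cases i <;> simp [Complex.re_add_im]
  · simp
end
end
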